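/- Let G be a graph having a universal vertex univ (adjacent to every other vertex of G) and let C be a vertex cover of G with univ∈C. Then the pathwidth of G satisfies pw(G) = min ppw(Q_last), the minimum being taken over all valid quintuples Q_last of the form (τ−, C∖{univ}, {univ}, ∅, forget(univ)). -/

import Mathlib

open scoped Classical

noncomputable section

/-- Operations labelling the nodes of a nice tree decomposition.  For a `join`
we record the trace of the bag on the vertex cover together with the traces of
the lower sets of the two children. -/
inductive TDOp (V : Type) where
  | introduce (u : V)
  | forget (u : V)
  | join (X L1 L2 : Set V)

/-- `i` is an ancestor of `j` (inclusively) with respect to the parent function `parent`. -/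
def ancestorOf {ι : Type} (parent : ι → ι) (i j : ι) : Prop :=
  ∃ n : ℕ, parent^[n] j = i

/-- `k` lies on the unique tree path between `i` and `j` in the rooted tree given by `parent`. -/
def betweenNodes {ι : Type} (parent : ι → ι) (k i j : ι) : Prop :=
  (ancestorOf parent k i ∨ ancestorOf parent k j) ∧
    ∀ l, ancestorOf parent l i → ancestorOf parent l j → ancestorOf parent l k

/-- A rooted tree decomposition of a graph `G`, encoded via a parent function on the
node set `ι`:  every node reaches the root by iterating `parent`; the bags cover the
vertices and the edges, and the set of bags containing a fixed vertex is connected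
(it is closed under taking nodes on tree paths). -/
structure RootedTreeDecomp (V ι : Type) (G : SimpleGraph V) where
  root : ι
  parent : ι → ι
  parent_root : parent root = root
  reaches_root : ∀ i, ancestorOf parent root i
  bag : ι → Finset V
  bag_cover : ∀ v, ∃ i, v ∈ bag i
  bag_edge : ∀ u v, G.Adj u v → ∃ i, u ∈ bag i ∧ v ∈ bag i
  bag_conn : ∀ v i j k, v ∈ bag i → v ∈ bag j → betweenNodes parent k i j → v ∈ bag k

namespace RootedTreeDecomp

variable {V ι : Type} {G : SimpleGraph V} (t : RootedTreeDecomp V ι G)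

/-- `i` is an ancestor of `j` (inclusively). -/
def anc (i j : ι) : Prop := ancestorOf t.parent i j

/-- `V_i` : the union of the bags of the subtree rooted at `i`. -/
def subVerts (i : ι) : Set V := {v | ∃ j, t.anc i j ∧ v ∈ t.bag j}

/-- `L_i = V_i ∖ X_i`. -/
def Lset (i : ι) : Set V := t.subVerts i \ ↑(t.bag i)

/-- `R_i = V ∖ V_i`. -/
def Rset (i : ι) : Set V := Set.univ \ t.subVerts i

/-- The trace of node `i` on `C` is the three-partition `(L_i ∩ C, X_i ∩ C, R_i ∩ C)` of `C`. -/
def HasTrace (C : Set V) (i : ι) (LC XC RC : Set V) : Prop :=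
  LC = t.Lset i ∩ C ∧ XC = (↑(t.bag i) : Set V) ∩ C ∧ RC = t.Rset i ∩ C

/-- The children of a node. -/
def children (i : ι) : Set ι := {j | j ≠ t.root ∧ t.parent j = i}

/-- A leaf node: no children and a bag of size one. -/
def IsLeafNode (i : ι) : Prop := t.children i = ∅ ∧ ∃ u, t.bag i = {u}

/-- An introduce node. -/
def IsIntroduceNode [DecidableEq V] (i : ι) : Prop :=
  ∃ j u, t.children i = {j} ∧ u ∉ t.bag j ∧ t.bag i = insert u (t.bag j)

/-- A forget node. -/
def IsForgetNode [DecidableEq V] (i : ι) : Prop :=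
  ∃ j u, t.children i = {j} ∧ u ∈ t.bag j ∧ t.bag i = (t.bag j).erase u

/-- A join node. -/
def IsJoinNode (i : ι) : Prop :=
  ∃ j k, j ≠ k ∧ t.children i = ({j, k} : Set ι) ∧ t.bag j = t.bag i ∧ t.bag k = t.bag i

/-- A nice tree decomposition: every node is a leaf, introduce, forget or join node. -/
def IsNice [DecidableEq V] : Prop :=
  ∀ i, t.IsLeafNode i ∨ t.IsIntroduceNode i ∨ t.IsForgetNode i ∨ t.IsJoinNode i

/-- A nice path decomposition: every node is a leaf, introduce or forget node. -/
def IsNicePath [DecidableEq V] : Prop :=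
  ∀ i, t.IsLeafNode i ∨ t.IsIntroduceNode i ∨ t.IsForgetNode i

/-- The operation `op` is the operation `τ_i` performed at node `i`
(join operations are recorded through their traces on the vertex cover `C`). -/
def HasOp [DecidableEq V] (C : Set V) (i : ι) : TDOp V → Prop
  | TDOp.introduce u =>
      (t.children i = ∅ ∧ t.bag i = {u}) ∨
        ∃ j, t.children i = {j} ∧ u ∉ t.bag j ∧ t.bag i = insert u (t.bag j)
  | TDOp.forget u =>
      ∃ j, t.children i = {j} ∧ u ∈ t.bag j ∧ t.bag i = (t.bag j).erase u
  | TDOp.join X L1 L2 =>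
      ∃ j k, j ≠ k ∧ t.children i = ({j, k} : Set ι) ∧ t.bag j = t.bag i ∧ t.bag k = t.bag i ∧
        X = (↑(t.bag i) : Set V) ∩ C ∧ L1 = t.Lset j ∩ C ∧ L2 = t.Lset k ∩ C

/-- The width of a rooted tree decomposition: maximum bag size minus one. -/
def width [Fintype ι] : ℕ := (Finset.univ.sup fun i => (t.bag i).card) - 1

end RootedTreeDecomp

/-- A quintuple `(τ₋, L^C, X^C, R^C, τ₊)`. -/
structure TDQuint (V : Type) where
  tauL : TDOp V
  LC : Set V
  XC : Set V
  RC : Set V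
  tauR : TDOp V

/-- `C` is a vertex cover of `G`. -/
def IsVertexCover {V : Type} (G : SimpleGraph V) (C : Set V) : Prop :=
  ∀ u v, G.Adj u v → u ∈ C ∨ v ∈ C

/-- `X` separates `A` from `B` in the subgraph of `G` induced by `D`: there is no walk
between a vertex of `A` and a vertex of `B` all of whose vertices avoid `X` and stay in `D`. -/
def SeparatesIn {V : Type} (G : SimpleGraph V) (D X A B : Set V) : Prop :=
  ∀ a ∈ A, ∀ b ∈ B, ¬ ∃ p : G.Walk a b, ∀ v ∈ p.support, v ∈ D \ X

/-- `(LC, XC, RC)` is a valid partition of `C`: it is the trace on `C` of some node of some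
rooted tree decomposition of `G`. -/
def ValidPartition {V : Type} (G : SimpleGraph V) (C LC XC RC : Set V) : Prop :=
  ∃ (ι : Type) (t : RootedTreeDecomp V ι G) (i : ι), t.HasTrace C i LC XC RC

section

variable {V ι : Type} [DecidableEq V] {G : SimpleGraph V}

/-- The decomposition `t` respects the (non-degenerate) quintuple `Q`, with `imin` and `imax`
as lowest and highest nodes of the subpath of nodes whose trace on `C` is `(LC, XC, RC)`:
the operation at `imin` is `τ₋`, and the operation at the father of `imax` is `τ₊`
(taken to be `forget w` on the root bag `{w}` when `imax` is the root). -/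
def RespectsAtND (t : RootedTreeDecomp V ι G) (C : Set V) (Q : TDQuint V)
    (imin imax : ι) : Prop :=
  t.HasTrace C imin Q.LC Q.XC Q.RC ∧ t.HasTrace C imax Q.LC Q.XC Q.RC ∧ t.anc imax imin ∧
    (∀ i, t.HasTrace C i Q.LC Q.XC Q.RC → t.anc i imin ∧ t.anc imax i) ∧
    t.HasOp C imin Q.tauL ∧
    ((imax = t.root ∧ ∃ w, t.bag t.root = {w} ∧ Q.tauR = TDOp.forget w) ∨
      (imax ≠ t.root ∧ t.HasOp C (t.parent imax) Q.tauR))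

/-- The decomposition `t` respects the degenerate quintuple `Q` at node `i`: node `i` has
trace `(∅, XC, RC)` on `C` and its father performs the forget operation `τ₊`. -/
def RespectsAtDeg (t : RootedTreeDecomp V ι G) (C : Set V) (Q : TDQuint V) (i : ι) : Prop :=
  t.HasTrace C i Q.LC Q.XC Q.RC ∧
    ∃ u, Q.tauR = TDOp.forget u ∧ i ≠ t.root ∧ t.HasOp C (t.parent i) (TDOp.forget u)

/-- The decomposition `t` respects the quintuple `Q`, witnessed by the nodes `imin`, `imax`. -/
def RespectsAt (t : RootedTreeDecomp V ι G) (C : Set V) (Q : TDQuint V)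
    (imin imax : ι) : Prop :=
  (Q.LC ≠ ∅ ∧ RespectsAtND t C Q imin imax) ∨
    (Q.LC = ∅ ∧ imin = imax ∧ RespectsAtDeg t C Q imax)

/-- The decomposition `t` respects the quintuple `Q`. -/
def Respects (t : RootedTreeDecomp V ι G) (C : Set V) (Q : TDQuint V) : Prop :=
  ∃ imin imax, RespectsAt t C Q imin imax

end

/-- Valid quintuples (tree-decomposition version), including the degenerate ones. -/
def ValidQuintT {V : Type} [DecidableEq V] (G : SimpleGraph V) (C : Set V)
    (Q : TDQuint V) : Prop :=
  (Q.LC ≠ ∅ ∧ ∃ (ι : Type) (t : RootedTreeDecomp V ι G), t.IsNice ∧ Respects t C Q) ∨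
    (Q.LC = ∅ ∧ ValidPartition G C ∅ Q.XC Q.RC ∧
      ∃ u, u ∈ Q.XC ∧ G.neighborSet u ⊆ Q.XC ∧ Q.tauR = TDOp.forget u)

/-- Valid quintuples (path-decomposition version): `Q` is respected by some nice path
decomposition of `G`. -/
def ValidQuintP {V : Type} [DecidableEq V] (G : SimpleGraph V) (C : Set V)
    (Q : TDQuint V) : Prop :=
  ∃ (ι : Type) (t : RootedTreeDecomp V ι G), t.IsNicePath ∧
    ∃ imin imax, RespectsAtND t C Q imin imax

section

variable {V : Type} [DecidableEq V]

/-- `XTR^S(Q)`: vertices of `S = V ∖ C` having neighbours in both `L^C` and `R^C`. -/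
def XTRset (G : SimpleGraph V) (C : Set V) (Q : TDQuint V) : Set V :=
  {x | x ∉ C ∧ (G.neighborSet x ∩ Q.LC).Nonempty ∧ (G.neighborSet x ∩ Q.RC).Nonempty}

/-- `XL^S(Q)`. -/
def XLset (G : SimpleGraph V) (C : Set V) (Q : TDQuint V) : Set V :=
  match Q.tauL with
  | TDOp.introduce u =>
      {x | x ∉ C ∧ G.neighborSet x ⊆ Q.LC ∪ Q.XC ∧ u ∈ G.neighborSet x ∧
        (G.neighborSet x ∩ Q.LC).Nonempty}
  | TDOp.forget _ => ∅
  | TDOp.join _ L1 L2 =>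
      {x | x ∉ C ∧ (G.neighborSet x ∩ L1).Nonempty ∧ (G.neighborSet x ∩ L2).Nonempty ∧
        G.neighborSet x ∩ Q.RC = ∅}

/-- `XR^S(Q)`. -/
def XRset (G : SimpleGraph V) (C : Set V) (Q : TDQuint V) : Set V :=
  match Q.tauR with
  | TDOp.forget v =>
      {x | x ∉ C ∧ G.neighborSet x ⊆ Q.RC ∪ Q.XC ∧ v ∈ G.neighborSet x ∧
        (G.neighborSet x ∩ Q.RC).Nonempty}
  | _ => ∅

/-- `ε(Q)` (treewidth version): `1` if some vertex of `S` has neighbourhood exactly `X^C`. -/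
def epsT (G : SimpleGraph V) (C : Set V) (Q : TDQuint V) : ℕ :=
  if ∃ x, x ∉ C ∧ G.neighborSet x = Q.XC then 1 else 0

/-- The local treewidth of a quintuple. -/
def loctw (G : SimpleGraph V) (C : Set V) (Q : TDQuint V) : ℕ :=
  Q.XC.ncard +
    max (max ((XTRset G C Q).ncard + (XLset G C Q).ncard)
      ((XTRset G C Q).ncard + (XRset G C Q).ncard)) (epsT G C Q) - 1

/-- Fuelled version of the partial treewidth recursion. -/
def ptwAux (G : SimpleGraph V) (C : Set V) : ℕ → TDQuint V → ℕ
  | 0, Q => loctw G C Q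
  | m + 1, Q =>
    if Q.LC = ∅ then loctw G C Q
    else
      match Q.tauL with
      | TDOp.introduce u =>
          max (loctw G C Q)
            (sInf {n | ∃ τ,
              ValidQuintT G C ⟨τ, Q.LC, Q.XC \ {u}, Q.RC ∪ {u}, TDOp.introduce u⟩ ∧
              n = ptwAux G C m ⟨τ, Q.LC, Q.XC \ {u}, Q.RC ∪ {u}, TDOp.introduce u⟩})
      | TDOp.forget u =>
          max (loctw G C Q)
            (sInf {n | ∃ τ,
              ValidQuintT G C ⟨τ, Q.LC \ {u}, Q.XC ∪ {u}, Q.RC, TDOp.forget u⟩ ∧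
              n = ptwAux G C m ⟨τ, Q.LC \ {u}, Q.XC ∪ {u}, Q.RC, TDOp.forget u⟩})
      | TDOp.join _ L1 L2 =>
          max (loctw G C Q)
            (max
              (sInf {n | ∃ τ,
                ValidQuintT G C ⟨τ, L1, Q.XC, Q.RC ∪ L2, TDOp.join Q.XC L1 L2⟩ ∧
                n = ptwAux G C m ⟨τ, L1, Q.XC, Q.RC ∪ L2, TDOp.join Q.XC L1 L2⟩})
              (sInf {n | ∃ τ,
                ValidQuintT G C ⟨τ, L2, Q.XC, Q.RC ∪ L1, TDOp.join Q.XC L1 L2⟩ ∧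
                n = ptwAux G C m ⟨τ, L2, Q.XC, Q.RC ∪ L1, TDOp.join Q.XC L1 L2⟩}))

/-- The partial treewidth `ptw(Q)` of a quintuple (defined with sufficient fuel:
each recursive step strictly decreases `2·|L^C| + |X^C|`). -/
def ptw (G : SimpleGraph V) (C : Set V) (Q : TDQuint V) : ℕ :=
  ptwAux G C (2 * Q.LC.ncard + Q.XC.ncard) Q

/-- `X^C_-` : the bag trace just below `imin`. -/
def XCminus (Q : TDQuint V) : Set V :=
  match Q.tauL with
  | TDOp.introduce u => Q.XC \ {u}
  | TDOp.forget u => Q.XC ∪ {u}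
  | TDOp.join _ _ _ => Q.XC

/-- `X^C_+` : the bag trace just above `imax`. -/
def XCplus (Q : TDQuint V) : Set V :=
  match Q.tauR with
  | TDOp.introduce v => Q.XC ∪ {v}
  | TDOp.forget v => Q.XC \ {v}
  | TDOp.join _ _ _ => Q.XC

/-- `XF^S(Q)` (pathwidth version). -/
def XFPset (G : SimpleGraph V) (C : Set V) (Q : TDQuint V) : Set V :=
  {x | x ∉ C ∧ G.neighborSet x ⊆ Q.XC ∧
    (XCminus Q ⊂ Q.XC → ¬ G.neighborSet x ⊆ XCminus Q) ∧
    (XCplus Q ⊂ Q.XC → ¬ G.neighborSet x ⊆ XCplus Q)}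

/-- `ε(Q)` (pathwidth version). -/
def epsP (G : SimpleGraph V) (C : Set V) (Q : TDQuint V) : ℕ :=
  if (XFPset G C Q).Nonempty then 1 else 0

/-- The local pathwidth of a quintuple. -/
def locpw (G : SimpleGraph V) (C : Set V) (Q : TDQuint V) : ℕ :=
  Q.XC.ncard + (XTRset G C Q).ncard +
    max (max (XLset G C Q).ncard (XRset G C Q).ncard) (epsP G C Q) - 1

/-- Fuelled version of the partial pathwidth recursion. -/
def ppwAux (G : SimpleGraph V) (C : Set V) : ℕ → TDQuint V → ℕ
  | 0, Q => locpw G C Q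
  | m + 1, Q =>
    if ∃ u, Q.tauL = TDOp.introduce u ∧ Q.LC = ∅ ∧ Q.XC = {u} ∧ Q.RC = C \ {u} then
      locpw G C Q
    else
      match Q.tauL with
      | TDOp.introduce u =>
          max (locpw G C Q)
            (sInf {n | ∃ τ,
              ValidQuintP G C ⟨τ, Q.LC, Q.XC \ {u}, Q.RC ∪ {u}, TDOp.introduce u⟩ ∧
              n = ppwAux G C m ⟨τ, Q.LC, Q.XC \ {u}, Q.RC ∪ {u}, TDOp.introduce u⟩})
      | TDOp.forget u =>
          max (locpw G C Q)
            (sInf {n | ∃ τ,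
              ValidQuintP G C ⟨τ, Q.LC \ {u}, Q.XC ∪ {u}, Q.RC, TDOp.forget u⟩ ∧
              n = ppwAux G C m ⟨τ, Q.LC \ {u}, Q.XC ∪ {u}, Q.RC, TDOp.forget u⟩})
      | TDOp.join _ _ _ => locpw G C Q

/-- The partial pathwidth `ppw(Q)` of a quintuple. -/
def ppw (G : SimpleGraph V) (C : Set V) (Q : TDQuint V) : ℕ :=
  ppwAux G C (2 * Q.LC.ncard + Q.XC.ncard) Q

end

end
/-- A (finite, unrooted) tree decomposition of a graph `G` with node set `ι`. -/
structure TreeDecomp (V ι : Type) (G : SimpleGraph V) where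
  tree : SimpleGraph ι
  tree_isTree : tree.IsTree
  bag : ι → Finset V
  bag_cover : ∀ v, ∃ i, v ∈ bag i
  bag_edge : ∀ u v, G.Adj u v → ∃ i, u ∈ bag i ∧ v ∈ bag i
  bag_conn : ∀ v : V, (SimpleGraph.induce {i | v ∈ bag i} tree).Connected

/-- The width of a tree decomposition: maximum bag size minus one. -/
def TreeDecomp.width {V ι : Type} [Fintype ι] {G : SimpleGraph V}
    (d : TreeDecomp V ι G) : ℕ :=
  (Finset.univ.sup fun i => (d.bag i).card) - 1

/-- The treewidth of `G`: minimum width over all tree decompositions of `G`. -/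
noncomputable def treewidth {V : Type} (G : SimpleGraph V) : ℕ :=
  sInf {w | ∃ (ι : Type) (inst : Fintype ι) (d : TreeDecomp V ι G),
    @TreeDecomp.width V ι inst G d ≤ w}

/-- A path decomposition of `G` with bags indexed by `Fin n`. -/
structure PathDecomp {V : Type} (G : SimpleGraph V) (n : ℕ) where
  bag : Fin n → Finset V
  bag_cover : ∀ v, ∃ i, v ∈ bag i
  bag_edge : ∀ u v, G.Adj u v → ∃ i, u ∈ bag i ∧ v ∈ bag i
  bag_conv : ∀ i j k : Fin n, i ≤ j → j ≤ k → ∀ v, v ∈ bag i → v ∈ bag k → v ∈ bag j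

/-- The width of a path decomposition: maximum bag size minus one. -/
def PathDecomp.width {V : Type} {G : SimpleGraph V} {n : ℕ} (d : PathDecomp G n) : ℕ :=
  (Finset.univ.sup fun i => (d.bag i).card) - 1

/-- The pathwidth of `G`: minimum width over all path decompositions of `G`. -/
noncomputable def pathwidth {V : Type} (G : SimpleGraph V) : ℕ :=
  sInf {w | ∃ (n : ℕ) (d : PathDecomp G n), d.width ≤ w}

/-- `pw(G; W)`: minimum width over all path decompositions of `G` having `W` as an end bag. -/
noncomputable def pathwidthEnd {V : Type} (G : SimpleGraph V) (W : Set V) : ℕ :=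
  sInf {w | ∃ (n : ℕ) (d : PathDecomp G (n + 1)),
    (↑(d.bag (Fin.last n)) : Set V) = W ∧ d.width ≤ w}

/-- The (open) neighbourhood `N(W)` of a set of vertices. -/
def nbhd {V : Type} (G : SimpleGraph V) (W : Set V) : Set V :=
  {u | u ∉ W ∧ ∃ v ∈ W, G.Adj v u}

/-- The closed neighbourhood `N[W]` of a set of vertices. -/
def closedNbhd {V : Type} (G : SimpleGraph V) (W : Set V) : Set V :=
  nbhd G W ∪ W

namespace RootedTreeDecomp

variable {V ι : Type} {G : SimpleGraph V} {t : RootedTreeDecomp V ι G}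

lemma anc_refl (i : ι) : t.anc i i := ⟨0, rfl⟩

lemma anc_trans {i j k : ι} (h₁ : t.anc i j) (h₂ : t.anc j k) : t.anc i k := by
  obtain ⟨a, rfl⟩ := h₁
  obtain ⟨b, rfl⟩ := h₂
  exact ⟨a + b, Function.iterate_add_apply _ _ _ _⟩

lemma anc_parent (i : ι) : t.anc (t.parent i) i := ⟨1, rfl⟩

lemma anc_root (i : ι) : t.anc t.root i := t.reaches_root i

lemma eq_or_anc_parent {i k : ι} (h : t.anc i k) : i = k ∨ t.anc i (t.parent k) := by
  obtain ⟨a, rfl⟩ := h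
  cases a with
  | zero => exact Or.inl rfl
  | succ a => exact Or.inr ⟨a, rfl⟩

lemma iterate_root (n : ℕ) : t.parent^[n] t.root = t.root :=
  Function.iterate_fixed t.parent_root n

lemma eq_root_of_iterate {i : ι} {n : ℕ} (hn : 0 < n) (h : t.parent^[n] i = i) : i = t.root := by
  obtain ⟨r, hr⟩ := t.reaches_root i
  have h₁ : t.parent^[n * r] i = i := by
    rw [Function.iterate_mul]
    exact Function.iterate_fixed h r
  obtain ⟨s, hs⟩ : ∃ s, n * r = s + r := ⟨n * r - r, by
    have := Nat.le_mul_of_pos_left r hn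
    omega⟩
  rw [hs, Function.iterate_add_apply, hr, iterate_root] at h₁
  exact h₁.symm

lemma anc_antisymm {i j : ι} (h₁ : t.anc i j) (h₂ : t.anc j i) : i = j := by
  obtain ⟨a, ha⟩ := h₁
  obtain ⟨b, hb⟩ := h₂
  rcases Nat.eq_zero_or_pos (a + b) with h | h
  · obtain rfl : a = 0 := by omega
    exact ha.symm
  · have hi : t.parent^[a + b] i = i := by rw [Function.iterate_add_apply, hb, ha]
    have hroot := eq_root_of_iterate h hi
    rw [hroot, iterate_root] at hb
    rw [hroot, hb]

lemma not_anc_parent {i : ι} (hi : i ≠ t.root) : ¬ t.anc i (t.parent i) := by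
  rintro ⟨n, hn⟩
  exact hi (eq_root_of_iterate (n := n + 1) n.succ_pos hn)

lemma anc_total_of_anc {i j k : ι} (hi : t.anc i k) (hj : t.anc j k) :
    t.anc i j ∨ t.anc j i := by
  obtain ⟨a, rfl⟩ := hi
  obtain ⟨b, rfl⟩ := hj
  rcases le_total a b with h | h
  · obtain ⟨c, rfl⟩ := Nat.exists_eq_add_of_le' h
    exact Or.inr ⟨c, (Function.iterate_add_apply _ _ _ _).symm⟩
  · obtain ⟨c, rfl⟩ := Nat.exists_eq_add_of_le' h
    exact Or.inl ⟨c, (Function.iterate_add_apply _ _ _ _).symm⟩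

lemma mem_bag_of_anc_of_not_anc {v : V} {i k l : ι} (hk : t.anc i k) (hl : ¬ t.anc i l)
    (hvk : v ∈ t.bag k) (hvl : v ∈ t.bag l) : v ∈ t.bag i := by
  refine t.bag_conn v k l i hvk hvl ⟨Or.inl hk, fun m hmk hml => ?_⟩
  rcases anc_total_of_anc hk hmk with h | h
  · exact absurd (anc_trans h hml) hl
  · exact h

lemma mem_bag_of_anc_anc {v : V} {i j k : ι} (hi : t.anc i j) (hk : t.anc j k)
    (hvi : v ∈ t.bag i) (hvk : v ∈ t.bag k) : v ∈ t.bag j := by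
  by_cases h : t.anc j i
  · rwa [anc_antisymm h hi]
  · exact mem_bag_of_anc_of_not_anc hk h hvk hvi

lemma mem_subVerts_of_mem_bag {v : V} {i : ι} (h : v ∈ t.bag i) : v ∈ t.subVerts i :=
  ⟨i, anc_refl i, h⟩

lemma mem_bag_of_mem_subVerts {v : V} {i l : ι} (h : v ∈ t.subVerts i) (hv : v ∈ t.bag l)
    (hl : ¬ t.anc i l) : v ∈ t.bag i := by
  obtain ⟨k, hk, hvk⟩ := h
  exact mem_bag_of_anc_of_not_anc hk hl hvk hv

lemma subVerts_root : t.subVerts t.root = Set.univ := by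
  refine Set.eq_univ_of_forall fun v => ?_
  obtain ⟨i, hi⟩ := t.bag_cover v
  exact ⟨i, anc_root i, hi⟩

lemma anc_of_mem_Lset {v : V} {i l : ι} (h : v ∈ t.Lset i) (hv : v ∈ t.bag l) : t.anc i l := by
  by_contra hl
  exact h.2 (mem_bag_of_mem_subVerts h.1 hv hl)

lemma mem_subVerts_of_adj_Lset {x y : V} {i : ι} (hy : y ∈ t.Lset i) (hxy : G.Adj x y) :
    x ∈ t.subVerts i := by
  obtain ⟨l, hx, hl⟩ := t.bag_edge x y hxy
  exact ⟨l, anc_of_mem_Lset hy hl, hx⟩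

lemma exists_bag_of_adj_Rset {x z : V} {i : ι} (hz : z ∈ t.Rset i) (hxz : G.Adj x z) :
    ∃ l, x ∈ t.bag l ∧ ¬ t.anc i l := by
  obtain ⟨l, hx, hl⟩ := t.bag_edge x z hxz
  exact ⟨l, hx, fun h => hz.2 ⟨l, h, hl⟩⟩

lemma not_adj_Lset_Rset {y z : V} {i : ι} (hy : y ∈ t.Lset i) (hz : z ∈ t.Rset i) :
    ¬ G.Adj y z := by
  intro h
  obtain ⟨l, hl, hnl⟩ := exists_bag_of_adj_Rset hz h
  exact hnl (anc_of_mem_Lset hy hl)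

lemma mem_bag_of_adj_Lset_of_adj_Rset {x y z : V} {i : ι} (hy : y ∈ t.Lset i) (hz : z ∈ t.Rset i)
    (hxy : G.Adj x y) (hxz : G.Adj x z) : x ∈ t.bag i := by
  obtain ⟨l, hl, hnl⟩ := exists_bag_of_adj_Rset hz hxz
  exact mem_bag_of_mem_subVerts (mem_subVerts_of_adj_Lset hy hxy) hl hnl

lemma parent_eq_of_children {i j : ι} (h : t.children i = {j}) : t.parent j = i := by
  have : j ∈ t.children i := by rw [h]; rfl
  exact this.2

lemma ne_root_of_children {i j : ι} (h : t.children i = {j}) : j ≠ t.root := by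
  have : j ∈ t.children i := by rw [h]; rfl
  exact this.1

lemma eq_or_anc_child {i j k : ι} (h : t.children i = {j}) (hk : t.anc i k) :
    k = i ∨ t.anc j k := by
  obtain ⟨n, hn⟩ := hk
  induction n generalizing k with
  | zero => exact Or.inl hn
  | succ n ih =>
    rcases ih hn with hp | hp
    · by_cases hr : k = t.root
      · left
        rw [← hp, hr, t.parent_root]
      · right
        have : k ∈ t.children i := ⟨hr, hp⟩
        rw [h] at this
        rw [this]
        exact anc_refl j
    · exact Or.inr (anc_trans hp (anc_parent k))

lemma eq_of_children_eq_empty {i k : ι} (h : t.children i = ∅) (hk : t.anc i k) : k = i := by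
  obtain ⟨n, hn⟩ := hk
  induction n generalizing k with
  | zero => exact hn
  | succ n ih =>
    have hp := ih hn
    by_cases hr : k = t.root
    · rw [← hp, hr, t.parent_root]
    · have : k ∈ t.children i := ⟨hr, hp⟩
      rw [h] at this
      exact this.elim

lemma subVerts_eq_of_children {i j : ι} (h : t.children i = {j}) :
    t.subVerts i = ↑(t.bag i) ∪ t.subVerts j := by
  ext v
  constructor
  · rintro ⟨k, hk, hv⟩
    rcases eq_or_anc_child h hk with rfl | hk
    · exact Or.inl hv
    · exact Or.inr ⟨k, hk, hv⟩
  · rintro (hv | ⟨k, hk, hv⟩)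
    · exact mem_subVerts_of_mem_bag hv
    · refine ⟨k, anc_trans ?_ hk, hv⟩
      rw [← parent_eq_of_children h]
      exact anc_parent j

lemma not_mem_subVerts_child {i j : ι} {u : V} (h : t.children i = {j}) (hi : u ∈ t.bag i)
    (hj : u ∉ t.bag j) : u ∉ t.subVerts j := by
  intro hu
  refine hj (mem_bag_of_mem_subVerts hu hi ?_)
  rw [← parent_eq_of_children h]
  exact not_anc_parent (ne_root_of_children h)

/-- Twice the number of vertices of `C` forgotten below `i` plus the number of vertices of `C`
in the bag of `i`. -/
noncomputable def progress (t : RootedTreeDecomp V ι G) (C : Set V) (i : ι) : ℕ :=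
  2 * (t.Lset i ∩ C).ncard + ((↑(t.bag i) : Set V) ∩ C).ncard

lemma HasTrace.progress_eq {C LC XC RC : Set V} {i : ι} (h : t.HasTrace C i LC XC RC) :
    t.progress C i = 2 * LC.ncard + XC.ncard := by
  rw [progress, ← h.1, ← h.2.1]

lemma hasTrace_self (t : RootedTreeDecomp V ι G) (C : Set V) (i : ι) :
    t.HasTrace C i (t.Lset i ∩ C) (↑(t.bag i) ∩ C) (t.Rset i ∩ C) :=
  ⟨rfl, rfl, rfl⟩

section Nice

variable [DecidableEq V]

/-- Node `i` has the single child `j` and introduces the vertex `u`. -/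
def IntroducesAt (t : RootedTreeDecomp V ι G) (i j : ι) (u : V) : Prop :=
  t.children i = {j} ∧ u ∉ t.bag j ∧ t.bag i = insert u (t.bag j)

/-- Node `i` has the single child `j` and forgets the vertex `u`. -/
def ForgetsAt (t : RootedTreeDecomp V ι G) (i j : ι) (u : V) : Prop :=
  t.children i = {j} ∧ u ∈ t.bag j ∧ t.bag i = (t.bag j).erase u

lemma IntroducesAt.mem {i j : ι} {u : V} (h : t.IntroducesAt i j u) : u ∈ t.bag i := by
  rw [h.2.2]
  exact Finset.mem_insert_self _ _

lemma IntroducesAt.mem_iff {i j : ι} {u : V} (h : t.IntroducesAt i j u) (v : V) :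
    v ∈ t.bag i ↔ v = u ∨ v ∈ t.bag j := by
  rw [h.2.2, Finset.mem_insert]

lemma IntroducesAt.not_mem_subVerts {i j : ι} {u : V} (h : t.IntroducesAt i j u) :
    u ∉ t.subVerts j :=
  not_mem_subVerts_child h.1 h.mem h.2.1

lemma IntroducesAt.mem_subVerts_iff {i j : ι} {u : V} (h : t.IntroducesAt i j u) (v : V) :
    v ∈ t.subVerts i ↔ v = u ∨ v ∈ t.subVerts j := by
  rw [subVerts_eq_of_children h.1, Set.mem_union, Finset.mem_coe, h.mem_iff]
  have := @mem_subVerts_of_mem_bag V ι G t v j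
  tauto

lemma ForgetsAt.mem_iff {i j : ι} {u : V} (h : t.ForgetsAt i j u) (v : V) :
    v ∈ t.bag i ↔ v ≠ u ∧ v ∈ t.bag j := by
  rw [h.2.2, Finset.mem_erase]

lemma ForgetsAt.mem_subVerts_iff {i j : ι} {u : V} (h : t.ForgetsAt i j u) (v : V) :
    v ∈ t.subVerts i ↔ v ∈ t.subVerts j := by
  rw [subVerts_eq_of_children h.1, Set.mem_union, Finset.mem_coe, h.mem_iff]
  have := @mem_subVerts_of_mem_bag V ι G t v j
  tauto

lemma ForgetsAt.not_mem {i j : ι} {u : V} (h : t.ForgetsAt i j u) : u ∉ t.bag i := by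
  rw [h.mem_iff]
  simp

lemma IntroducesAt.hasTrace {C LC XC RC : Set V} {i j : ι} {u : V} (h : t.IntroducesAt i j u)
    (hu : u ∈ C) (hi : t.HasTrace C i LC XC RC) :
    t.HasTrace C j LC (XC \ {u}) (RC ∪ {u}) ∧ u ∈ XC := by
  obtain ⟨rfl, rfl, rfl⟩ := hi
  have hj := h.2.1
  have hs := h.not_mem_subVerts
  refine ⟨⟨?_, ?_, ?_⟩, h.mem, hu⟩
  · ext v
    simp only [Lset, Set.mem_inter_iff, Set.mem_sdiff, Finset.mem_coe, h.mem_iff,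
      h.mem_subVerts_iff]
    by_cases hv : v = u
    · subst hv; tauto
    · tauto
  · ext v
    simp only [Set.mem_inter_iff, Set.mem_sdiff, Finset.mem_coe, h.mem_iff,
      Set.mem_singleton_iff]
    by_cases hv : v = u
    · subst hv; tauto
    · tauto
  · ext v
    simp only [Rset, Set.mem_inter_iff, Set.mem_sdiff, Set.mem_univ, Set.mem_union,
      h.mem_subVerts_iff, Set.mem_singleton_iff]
    by_cases hv : v = u
    · subst hv; tauto
    · tauto

lemma ForgetsAt.hasTrace {C LC XC RC : Set V} {i j : ι} {u : V} (h : t.ForgetsAt i j u)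
    (hu : u ∈ C) (hi : t.HasTrace C i LC XC RC) :
    t.HasTrace C j (LC \ {u}) (XC ∪ {u}) RC ∧ u ∈ LC := by
  obtain ⟨rfl, rfl, rfl⟩ := hi
  have hj := h.2.1
  have hs := mem_subVerts_of_mem_bag hj
  refine ⟨⟨?_, ?_, ?_⟩, ⟨?_, h.not_mem⟩, hu⟩
  · ext v
    simp only [Lset, Set.mem_inter_iff, Set.mem_sdiff, Finset.mem_coe, h.mem_iff,
      h.mem_subVerts_iff, Set.mem_singleton_iff]
    by_cases hv : v = u
    · subst hv; tauto
    · tauto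
  · ext v
    simp only [Set.mem_inter_iff, Set.mem_union, Finset.mem_coe, h.mem_iff,
      Set.mem_singleton_iff]
    by_cases hv : v = u
    · subst hv; tauto
    · tauto
  · ext v
    simp only [Rset, Set.mem_inter_iff, Set.mem_sdiff, Set.mem_univ, h.mem_subVerts_iff]
  · rwa [h.mem_subVerts_iff]

lemma IntroducesAt.hasTrace_of_not_mem {C LC XC RC : Set V} {i j : ι} {u : V}
    (h : t.IntroducesAt i j u) (hu : u ∉ C) :
    t.HasTrace C i LC XC RC ↔ t.HasTrace C j LC XC RC := by
  have hL : t.Lset i ∩ C = t.Lset j ∩ C := by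
    ext v
    simp only [Lset, Set.mem_inter_iff, Set.mem_sdiff, Finset.mem_coe, h.mem_iff,
      h.mem_subVerts_iff]
    by_cases hv : v = u
    · subst hv; tauto
    · tauto
  have hX : (↑(t.bag i) : Set V) ∩ C = ↑(t.bag j) ∩ C := by
    ext v
    simp only [Set.mem_inter_iff, Finset.mem_coe, h.mem_iff]
    by_cases hv : v = u
    · subst hv; tauto
    · tauto
  have hR : t.Rset i ∩ C = t.Rset j ∩ C := by
    ext v
    simp only [Rset, Set.mem_inter_iff, Set.mem_sdiff, h.mem_subVerts_iff]
    by_cases hv : v = u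
    · subst hv; tauto
    · tauto
  rw [HasTrace, HasTrace, hL, hX, hR]

lemma ForgetsAt.hasTrace_of_not_mem {C LC XC RC : Set V} {i j : ι} {u : V}
    (h : t.ForgetsAt i j u) (hu : u ∉ C) :
    t.HasTrace C i LC XC RC ↔ t.HasTrace C j LC XC RC := by
  have hL : t.Lset i ∩ C = t.Lset j ∩ C := by
    ext v
    simp only [Lset, Set.mem_inter_iff, Set.mem_sdiff, Finset.mem_coe, h.mem_iff,
      h.mem_subVerts_iff]
    by_cases hv : v = u
    · subst hv; tauto
    · tauto
  have hX : (↑(t.bag i) : Set V) ∩ C = ↑(t.bag j) ∩ C := by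
    ext v
    simp only [Set.mem_inter_iff, Finset.mem_coe, h.mem_iff]
    by_cases hv : v = u
    · subst hv; tauto
    · tauto
  have hR : t.Rset i ∩ C = t.Rset j ∩ C := by
    ext v
    simp only [Rset, Set.mem_inter_iff, Set.mem_sdiff, h.mem_subVerts_iff]
  rw [HasTrace, HasTrace, hL, hX, hR]

lemma IntroducesAt.progress_eq [Finite V] {C : Set V} {i j : ι} {u : V}
    (h : t.IntroducesAt i j u) (hu : u ∈ C) : t.progress C i = t.progress C j + 1 := by
  obtain ⟨hj, hX⟩ := h.hasTrace hu (hasTrace_self t C i)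
  rw [hj.progress_eq, progress, ← Set.ncard_sdiff_singleton_add_one hX]
  ring

lemma ForgetsAt.progress_eq [Finite V] {C : Set V} {i j : ι} {u : V}
    (h : t.ForgetsAt i j u) (hu : u ∈ C) : t.progress C i = t.progress C j + 1 := by
  obtain ⟨hj, hL⟩ := h.hasTrace hu (hasTrace_self t C i)
  have hX : u ∉ (↑(t.bag i) : Set V) ∩ C := fun hm => h.not_mem hm.1
  rw [hj.progress_eq, progress, ← Set.ncard_sdiff_singleton_add_one hL,
    Set.union_singleton, Set.ncard_insert_of_notMem hX]
  ring

lemma IntroducesAt.progress_eq_of_not_mem {C : Set V} {i j : ι} {u : V}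
    (h : t.IntroducesAt i j u) (hu : u ∉ C) : t.progress C i = t.progress C j := by
  rw [((h.hasTrace_of_not_mem hu).1 (hasTrace_self t C i)).progress_eq, progress]

lemma ForgetsAt.progress_eq_of_not_mem {C : Set V} {i j : ι} {u : V}
    (h : t.ForgetsAt i j u) (hu : u ∉ C) : t.progress C i = t.progress C j := by
  rw [((h.hasTrace_of_not_mem hu).1 (hasTrace_self t C i)).progress_eq, progress]

lemma IsNicePath.cases (ht : t.IsNicePath) (i : ι) :
    (t.children i = ∅ ∧ ∃ u, t.bag i = {u}) ∨ (∃ j u, t.IntroducesAt i j u) ∨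
      ∃ j u, t.ForgetsAt i j u :=
  ht i

lemma IsNicePath.children_eq (ht : t.IsNicePath) {i k : ι} (hk : k ∈ t.children i) :
    t.children i = {k} ∧ ((∃ u, t.IntroducesAt i k u) ∨ ∃ u, t.ForgetsAt i k u) := by
  rcases ht.cases i with ⟨h, -⟩ | ⟨j, u, h⟩ | ⟨j, u, h⟩
  · rw [h] at hk
    exact hk.elim
  · have hk' := hk
    rw [h.1] at hk'
    obtain rfl : k = j := hk'
    exact ⟨h.1, Or.inl ⟨u, h⟩⟩
  · have hk' := hk
    rw [h.1] at hk'
    obtain rfl : k = j := hk'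
    exact ⟨h.1, Or.inr ⟨u, h⟩⟩

lemma IsNicePath.progress_parent_le [Finite V] (ht : t.IsNicePath) (C : Set V) (i : ι) :
    t.progress C i ≤ t.progress C (t.parent i) := by
  by_cases hi : i = t.root
  · rw [hi, t.parent_root]
  · rcases (ht.children_eq (i := t.parent i) (k := i) ⟨hi, rfl⟩).2 with ⟨u, h⟩ | ⟨u, h⟩
    · by_cases hu : u ∈ C
      · rw [h.progress_eq hu]; omega
      · rw [h.progress_eq_of_not_mem hu]
    · by_cases hu : u ∈ C
      · rw [h.progress_eq hu]; omega
      · rw [h.progress_eq_of_not_mem hu]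

lemma IsNicePath.progress_mono [Finite V] (ht : t.IsNicePath) (C : Set V) {i k : ι}
    (h : t.anc i k) : t.progress C k ≤ t.progress C i := by
  obtain ⟨n, rfl⟩ := h
  induction n with
  | zero => exact le_rfl
  | succ n ih =>
    rw [Function.iterate_succ_apply']
    exact ih.trans (ht.progress_parent_le C _)

lemma IsNicePath.progress_univ_lt [Finite V] (ht : t.IsNicePath) {i k : ι} (h : t.anc i k)
    (hne : k ≠ i) : t.progress Set.univ k < t.progress Set.univ i := by
  have hk : k ≠ t.root := by
    rintro rfl
    exact hne (anc_antisymm (anc_root i) h)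
  have h₁ : t.progress Set.univ k < t.progress Set.univ (t.parent k) := by
    rcases (ht.children_eq (i := t.parent k) (k := k) ⟨hk, rfl⟩).2 with ⟨u, h⟩ | ⟨u, h⟩
    · rw [h.progress_eq (Set.mem_univ u)]; omega
    · rw [h.progress_eq (Set.mem_univ u)]; omega
  rcases eq_or_anc_parent h with rfl | h
  · exact absurd rfl hne
  · exact h₁.trans_le (ht.progress_mono _ h)

lemma IsNicePath.anc_total (ht : t.IsNicePath) (i k : ι) : t.anc i k ∨ t.anc k i := by
  obtain ⟨n, hn⟩ := t.reaches_root i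
  induction n generalizing i with
  | zero =>
    left
    rw [Function.iterate_zero_apply] at hn
    rw [hn]
    exact anc_root k
  | succ n ih =>
    rcases ih (t.parent i) hn with h | h
    · by_cases hi : i = t.root
      · left
        rw [hi]
        exact anc_root k
      · have hc := (ht.children_eq (i := t.parent i) (k := i) ⟨hi, rfl⟩).1
        rcases eq_or_anc_child hc h with rfl | h
        · exact Or.inr (anc_parent i)
        · exact Or.inl h
    · exact Or.inr (anc_trans h (anc_parent i))

lemma IsNicePath.exists_hasOp (ht : t.IsNicePath) (C : Set V) (i : ι) :
    ∃ τ, t.HasOp C i τ := by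
  rcases ht.cases i with ⟨h, u, hu⟩ | ⟨j, u, h⟩ | ⟨j, u, h⟩
  · exact ⟨TDOp.introduce u, Or.inl ⟨h, hu⟩⟩
  · exact ⟨TDOp.introduce u, Or.inr ⟨j, h⟩⟩
  · exact ⟨TDOp.forget u, j, h⟩

lemma IsNicePath.not_hasOp_join (ht : t.IsNicePath) {C X L₁ L₂ : Set V} {i : ι} :
    ¬ t.HasOp C i (TDOp.join X L₁ L₂) := by
  rintro ⟨j, k, hjk, hc, -⟩
  have hj : j ∈ t.children i := by rw [hc]; exact Or.inl rfl
  have hk : k ∈ t.children i := by rw [hc]; exact Or.inr rfl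
  rw [(ht.children_eq hj).1] at hk
  exact hjk hk.symm

lemma IsNicePath.exists_lowest [Finite V] (ht : t.IsNicePath) {C LC XC RC : Set V} {j : ι}
    (hj : t.HasTrace C j LC XC RC) :
    ∃ imin, t.HasTrace C imin LC XC RC ∧ ∀ k, t.HasTrace C k LC XC RC → t.anc k imin := by
  obtain ⟨imin, hmin, hle⟩ := exists_minimal_of_wellFoundedLT
    (fun n => ∃ k, t.HasTrace C k LC XC RC ∧ t.progress Set.univ k = n) ⟨_, j, hj, rfl⟩
  obtain ⟨i, hi, rfl⟩ := hmin
  refine ⟨i, hi, fun k hk => ?_⟩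
  rcases ht.anc_total k i with h | h
  · exact h
  · by_contra hn
    have hlt := ht.progress_univ_lt h (by rintro rfl; exact hn h)
    have := hle ⟨k, hk, rfl⟩ hlt.le
    omega

end Nice

end RootedTreeDecomp

lemma RootedTreeDecomp.HasTrace.trichotomy {V ι : Type} {G : SimpleGraph V}
    {t : RootedTreeDecomp V ι G} {C LC XC RC : Set V} {i : ι} (h : t.HasTrace C i LC XC RC) (v : V) :
    (v ∈ C ↔ v ∈ LC ∨ v ∈ XC ∨ v ∈ RC) ∧ ¬ (v ∈ LC ∧ v ∈ XC) ∧ ¬ (v ∈ LC ∧ v ∈ RC) ∧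
      ¬ (v ∈ XC ∧ v ∈ RC) := by
  obtain ⟨rfl, rfl, rfl⟩ := h
  have := @RootedTreeDecomp.mem_subVerts_of_mem_bag V ι G t v i
  simp only [RootedTreeDecomp.Lset, RootedTreeDecomp.Rset, Set.mem_inter_iff, Set.mem_sdiff,
    Set.mem_univ, Finset.mem_coe]
  tauto

/-- `Q` is the base quintuple `(introduce(u), ∅, {u}, C ∖ {u}, τ₊)` for some `u`. -/
def IsBaseQuint {V : Type} (C : Set V) (Q : TDQuint V) : Prop :=
  ∃ u, Q.tauL = TDOp.introduce u ∧ Q.LC = ∅ ∧ Q.XC = {u} ∧ Q.RC = C \ {u}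

/-- `Q'` has the shape required of a quintuple immediately below `Q`. -/
def IsPredQuint {V : Type} (Q' Q : TDQuint V) : Prop :=
  (∃ u τ, Q.tauL = TDOp.introduce u ∧ u ∈ Q.XC ∧
      Q' = ⟨τ, Q.LC, Q.XC \ {u}, Q.RC ∪ {u}, TDOp.introduce u⟩) ∨
    ∃ u τ, Q.tauL = TDOp.forget u ∧ u ∈ Q.LC ∧ u ∉ Q.XC ∧
      Q' = ⟨τ, Q.LC \ {u}, Q.XC ∪ {u}, Q.RC, TDOp.forget u⟩

open RootedTreeDecomp in
lemma XTRset_subset {V ι : Type} {G : SimpleGraph V} {t : RootedTreeDecomp V ι G} {C : Set V}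
    {Q : TDQuint V} {i : ι} (hi : t.HasTrace C i Q.LC Q.XC Q.RC) :
    XTRset G C Q ⊆ ↑(t.bag i) := by
  rintro x ⟨-, ⟨y, hxy, hy⟩, z, hxz, hz⟩
  rw [hi.1] at hy
  rw [hi.2.2] at hz
  exact mem_bag_of_adj_Lset_of_adj_Rset hy.1 hz.1 hxy hxz

section

open RootedTreeDecomp

variable {V ι : Type} [DecidableEq V] {G : SimpleGraph V} {t : RootedTreeDecomp V ι G}
  {C : Set V} {Q : TDQuint V} {imin imax : ι}

lemma exists_respectsAtND_of_child [Finite V] (ht : t.IsNicePath) {i j : ι} {L X R : Set V}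
    {τ : TDOp V} (hc : t.children i = {j}) (hj : t.HasTrace C j L X R)
    (hlt : t.progress C j < t.progress C i) (hτ : t.HasOp C i τ) :
    ∃ τ' k, RespectsAtND t C ⟨τ', L, X, R, τ⟩ k j := by
  obtain ⟨k, hk, hlow⟩ := ht.exists_lowest hj
  obtain ⟨τ', hτ'⟩ := ht.exists_hasOp C k
  refine ⟨τ', k, hk, hj, hlow j hj, fun l hl => ⟨hlow l hl, ?_⟩, hτ',
    Or.inr ⟨ne_root_of_children hc, ?_⟩⟩
  · rcases ht.anc_total j l with h | h
    · exact h
    · rcases eq_or_anc_parent h with rfl | h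
      · exact anc_refl _
      · rw [parent_eq_of_children hc] at h
        have h₁ := ht.progress_mono C h
        have h₂ : t.progress C l = t.progress C j := by rw [hl.progress_eq, hj.progress_eq]
        omega
  · rwa [parent_eq_of_children hc]

lemma RespectsAtND.mem_of_introducesAt (h : RespectsAtND t C Q imin imax) {j : ι} {u : V}
    (hu : t.IntroducesAt imin j u) : u ∈ C := by
  by_contra hn
  have := (h.2.2.2.1 j ((hu.hasTrace_of_not_mem hn).1 h.1)).1
  rw [← parent_eq_of_children hu.1] at this
  exact not_anc_parent (ne_root_of_children hu.1) this

lemma RespectsAtND.mem_of_forgetsAt (h : RespectsAtND t C Q imin imax) {j : ι} {u : V}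
    (hu : t.ForgetsAt imin j u) : u ∈ C := by
  by_contra hn
  have := (h.2.2.2.1 j ((hu.hasTrace_of_not_mem hn).1 h.1)).1
  rw [← parent_eq_of_children hu.1] at this
  exact not_anc_parent (ne_root_of_children hu.1) this

lemma RespectsAtND.mem_of_forgetsAt_parent (h : RespectsAtND t C Q imin imax) {p : ι} {u : V}
    (hu : t.ForgetsAt p imax u) : u ∈ C := by
  by_contra hn
  have := (h.2.2.2.1 p ((hu.hasTrace_of_not_mem hn).2 h.2.1)).2
  rw [← parent_eq_of_children hu.1] at this
  exact not_anc_parent (ne_root_of_children hu.1) this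

lemma RespectsAtND.base_or_exists_pred [Finite V] (ht : t.IsNicePath)
    (h : RespectsAtND t C Q imin imax) (hne : Q.LC.Nonempty ∨ Q.XC.Nonempty) :
    IsBaseQuint C Q ∨ ∃ Q' imin' imax', IsPredQuint Q' Q ∧ RespectsAtND t C Q' imin' imax' := by
  have hop := h.2.2.2.2.1
  have htr := h.1
  rcases hτ : Q.tauL with u | u | ⟨X, L₁, L₂⟩
  · rw [hτ] at hop
    rcases hop with ⟨hc, hb⟩ | ⟨j, hj⟩
    · left
      have hs : t.subVerts imin = {u} := by
        ext v
        constructor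
        · rintro ⟨k, hk, hv⟩
          rw [eq_of_children_eq_empty hc hk, hb] at hv
          simpa using hv
        · rintro rfl
          exact mem_subVerts_of_mem_bag (by rw [hb]; simp)
      have hL : Q.LC = ∅ := by rw [htr.1, Lset, hs, hb]; simp
      have hX : Q.XC = {u} ∩ C := by rw [htr.2.1, hb]; simp
      have hu : u ∈ C := by
        rcases hne with hne | ⟨x, hx⟩
        · rw [hL] at hne
          exact absurd hne Set.not_nonempty_empty
        · rw [hX] at hx
          obtain ⟨rfl, hx⟩ := hx
          exact hx
      refine ⟨u, hτ, hL, ?_, ?_⟩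
      · rw [hX]
        exact Set.inter_eq_left.2 (Set.singleton_subset_iff.2 hu)
      · rw [htr.2.2, Rset, hs]
        ext v
        simp only [Set.mem_inter_iff, Set.mem_sdiff, Set.mem_univ]
        tauto
    · right
      have hj : t.IntroducesAt imin j u := hj
      have hu := h.mem_of_introducesAt hj
      obtain ⟨hjt, hX⟩ := hj.hasTrace hu htr
      obtain ⟨τ', k, hk⟩ := exists_respectsAtND_of_child ht hj.1 hjt
        (by rw [hj.progress_eq hu]; omega) (τ := TDOp.introduce u) (Or.inr ⟨j, hj⟩)
      exact ⟨_, k, j, Or.inl ⟨u, τ', hτ, hX, rfl⟩, hk⟩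
  · right
    rw [hτ] at hop
    obtain ⟨j, hj⟩ := hop
    have hj : t.ForgetsAt imin j u := hj
    have hu := h.mem_of_forgetsAt hj
    obtain ⟨hjt, hL⟩ := hj.hasTrace hu htr
    obtain ⟨τ', k, hk⟩ := exists_respectsAtND_of_child ht hj.1 hjt
      (by rw [hj.progress_eq hu]; omega) (τ := TDOp.forget u) ⟨j, hj⟩
    exact ⟨_, k, j, Or.inr ⟨u, τ', hτ, hL, fun hX => (htr.trichotomy u).2.1 ⟨hL, hX⟩, rfl⟩, hk⟩
  · rw [hτ] at hop
    exact absurd hop ht.not_hasOp_join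

lemma not_anc_of_introduce {i l : ι} {u : V} (h : t.HasOp C i (TDOp.introduce u))
    (hu : u ∈ t.bag l) (hl : t.anc i l) : l = i := by
  rcases h with ⟨hc, -⟩ | ⟨j, hj⟩
  · exact eq_of_children_eq_empty hc hl
  · have hj : t.IntroducesAt i j u := hj
    rcases eq_or_anc_child hj.1 hl with rfl | hl
    · rfl
    · exact absurd ⟨l, hl, hu⟩ hj.not_mem_subVerts

lemma mem_bag_of_introduce {i : ι} {u : V} (h : t.HasOp C i (TDOp.introduce u)) :
    u ∈ t.bag i := by
  rcases h with ⟨-, hb⟩ | ⟨j, hj⟩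
  · rw [hb]; simp
  · exact IntroducesAt.mem hj

lemma RootedTreeDecomp.ForgetsAt.anc_of_mem {p i l : ι} {v : V} (h : t.ForgetsAt p i v)
    (hl : v ∈ t.bag l) : t.anc i l := by
  by_contra hn
  have hv : v ∈ t.subVerts p := by
    rw [h.mem_subVerts_iff]
    exact mem_subVerts_of_mem_bag h.2.1
  have hp : t.anc p l := by
    by_contra hp
    exact h.not_mem (mem_bag_of_mem_subVerts hv hl hp)
  rcases eq_or_anc_child h.1 hp with rfl | hp
  · exact h.not_mem hl
  · exact hn hp

lemma RespectsAtND.forgetsAt_of_tauR (h : RespectsAtND t C Q imin imax) {v : V}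
    (hτ : Q.tauR = TDOp.forget v) :
    (imax = t.root ∧ t.bag imax = {v}) ∨ ∃ p, t.ForgetsAt p imax v := by
  rcases h.2.2.2.2.2 with ⟨hr, w, hw, hw'⟩ | ⟨hr, hop⟩
  · rw [hτ] at hw'
    obtain rfl : v = w := by injection hw'
    exact Or.inl ⟨hr, hr ▸ hw⟩
  · rw [hτ] at hop
    obtain ⟨j, hj⟩ := hop
    have hj : t.ForgetsAt (t.parent imax) j v := hj
    have hm : imax ∈ t.children (t.parent imax) := ⟨hr, rfl⟩
    rw [hj.1] at hm
    obtain rfl : imax = j := hm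
    exact Or.inr ⟨_, hj⟩

lemma RespectsAtND.XLset_subset (ht : t.IsNicePath) (h : RespectsAtND t C Q imin imax) :
    XLset G C Q ⊆ ↑(t.bag imin) := by
  intro x hx
  have hop := h.2.2.2.2.1
  have htr := h.1
  rcases hτ : Q.tauL with u | u | ⟨X, L₁, L₂⟩
  · simp only [XLset, hτ] at hx
    obtain ⟨-, -, hu, y, hxy, hy⟩ := hx
    rw [htr.1] at hy
    rw [hτ] at hop
    have hxs := mem_subVerts_of_adj_Lset hy.1 hxy
    obtain ⟨l, hl, hul⟩ := t.bag_edge x u hu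
    by_cases hi : t.anc imin l
    · rw [← not_anc_of_introduce hop hul hi]
      exact hl
    · exact mem_bag_of_mem_subVerts hxs hl hi
  · simp [XLset, hτ] at hx
  · rw [hτ] at hop
    exact absurd hop ht.not_hasOp_join

lemma RespectsAtND.XRset_subset (h : RespectsAtND t C Q imin imax) :
    XRset G C Q ⊆ ↑(t.bag imax) := by
  intro x hx
  rcases hτ : Q.tauR with v | v | ⟨X, L₁, L₂⟩
  · simp [XRset, hτ] at hx
  · simp only [XRset, hτ] at hx
    obtain ⟨-, -, hv, z, hxz, hz⟩ := hx
    rw [h.2.1.2.2] at hz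
    rcases h.forgetsAt_of_tauR hτ with ⟨hr, -⟩ | ⟨p, hp⟩
    · rw [hr] at hz
      exact absurd (by rw [subVerts_root]; trivial) hz.1.2
    · obtain ⟨l, hl, hnl⟩ := exists_bag_of_adj_Rset hz.1 hxz
      obtain ⟨l', hl', hvl'⟩ := t.bag_edge x v hv
      exact mem_bag_of_anc_of_not_anc (hp.anc_of_mem hvl') hnl hl' hl
  · simp [XRset, hτ] at hx

end

lemma card_add_card_add_card_le {V : Type} [Finite V] {A B D : Set V} {s : Finset V}
    (h : A ∪ B ∪ D ⊆ ↑s) (hAB : Disjoint A B) (hABD : Disjoint (A ∪ B) D) :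
    A.ncard + B.ncard + D.ncard ≤ s.card := by
  rw [← Set.ncard_union_eq hAB (Set.toFinite _) (Set.toFinite _),
    ← Set.ncard_union_eq hABD (Set.toFinite _) (Set.toFinite _), ← Set.ncard_coe_finset]
  exact Set.ncard_le_ncard h (Set.toFinite _)

lemma IsPredQuint.measure_eq {V : Type} [Finite V] {Q Q' : TDQuint V} (h : IsPredQuint Q' Q) :
    2 * Q.LC.ncard + Q.XC.ncard = 2 * Q'.LC.ncard + Q'.XC.ncard + 1 := by
  rcases h with ⟨u, τ, -, hu, rfl⟩ | ⟨u, τ, -, hu, hu', rfl⟩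
  · simp only
    rw [← Set.ncard_sdiff_singleton_add_one hu]
    ring
  · simp only
    rw [Set.union_singleton, Set.ncard_insert_of_notMem hu',
      ← Set.ncard_sdiff_singleton_add_one hu]
    ring

lemma nonempty_of_measure_pos {V : Type} {Q : TDQuint V} {m : ℕ}
    (h : 2 * Q.LC.ncard + Q.XC.ncard = m + 1) :
    Q.LC.Nonempty ∨ Q.XC.Nonempty := by
  by_contra hn
  rw [not_or, Set.not_nonempty_iff_eq_empty, Set.not_nonempty_iff_eq_empty] at hn
  rw [hn.1, hn.2, Set.ncard_empty] at h
  omega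

section

open RootedTreeDecomp

variable {V ι : Type} [DecidableEq V] {G : SimpleGraph V} {t : RootedTreeDecomp V ι G}
  {C : Set V} {Q : TDQuint V} {imin imax : ι}

lemma RespectsAtND.XC_subset_XTR_union (h : RespectsAtND t C Q imin imax) {i : ι}
    (h₁ : t.anc imax i) (h₂ : t.anc i imin) :
    Q.XC ∪ XTRset G C Q ⊆ ↑(t.bag i) := by
  have hmin : Q.XC ∪ XTRset G C Q ⊆ ↑(t.bag imin) := by
    refine Set.union_subset ?_ (XTRset_subset h.1)
    rw [h.1.2.1]
    exact Set.inter_subset_left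
  have hmax : Q.XC ∪ XTRset G C Q ⊆ ↑(t.bag imax) := by
    refine Set.union_subset ?_ (XTRset_subset h.2.1)
    rw [h.2.1.2.1]
    exact Set.inter_subset_left
  exact fun x hx => mem_bag_of_anc_anc h₁ h₂ (hmax hx) (hmin hx)

lemma RespectsAtND.disjoint_XC_XTRset (h : RespectsAtND t C Q imin imax) :
    Disjoint Q.XC (XTRset G C Q) := by
  rw [Set.disjoint_left]
  intro x hx hx'
  exact hx'.1 (((h.1.trichotomy x).1).2 (Or.inr (Or.inl hx)))

lemma RespectsAtND.exists_bag_of_mem_XFPset (ht : t.IsNicePath)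
    (h : RespectsAtND t C Q imin imax) (hC : ∀ i, ∃ v ∈ C, v ∈ t.bag i) {u v x : V}
    (hu : Q.tauL = TDOp.introduce u) (hv : Q.tauR = TDOp.forget v) (hx : x ∈ XFPset G C Q) :
    ∃ i, t.anc imax i ∧ t.anc i imin ∧ x ∈ t.bag i := by
  obtain ⟨-, hX, hm, hp⟩ := hx
  have hop := h.2.2.2.2.1
  rw [hu] at hop
  have huC : u ∈ C := by
    rcases hop with ⟨-, hb⟩ | ⟨j, hj⟩
    · obtain ⟨w, hw, hwb⟩ := hC imin
      rw [hb, Finset.mem_singleton] at hwb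
      rwa [← hwb]
    · exact h.mem_of_introducesAt hj
  have huX : u ∈ Q.XC := by
    rw [h.1.2.1]
    exact ⟨mem_bag_of_introduce hop, huC⟩
  have hxu : G.Adj x u := by
    have := hm (by simp only [XCminus, hu]; exact Set.sdiff_singleton_ssubset.2 huX)
    by_contra hn
    refine this fun y hy => ?_
    simp only [XCminus, hu]
    exact ⟨hX hy, by rintro rfl; exact hn hy⟩
  obtain ⟨l, hxl, hul⟩ := t.bag_edge x u hxu
  obtain ⟨l₂, hl₂, hxl₂⟩ : ∃ l₂, t.anc imax l₂ ∧ x ∈ t.bag l₂ := by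
    rcases h.forgetsAt_of_tauR hv with ⟨hr, -⟩ | ⟨p, hpf⟩
    · exact ⟨l, hr ▸ anc_root l, hxl⟩
    · have hvX : v ∈ Q.XC := by
        rw [h.2.1.2.1]
        exact ⟨hpf.2.1, h.mem_of_forgetsAt_parent hpf⟩
      have hxv : G.Adj x v := by
        have := hp (by simp only [XCplus, hv]; exact Set.sdiff_singleton_ssubset.2 hvX)
        by_contra hn
        refine this fun y hy => ?_
        simp only [XCplus, hv]
        exact ⟨hX hy, by rintro rfl; exact hn hy⟩
      obtain ⟨l₂, hxl₂, hvl₂⟩ := t.bag_edge x v hxv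
      exact ⟨l₂, hpf.anc_of_mem hvl₂, hxl₂⟩
  rcases ht.anc_total imin l₂ with hml | hml
  · refine ⟨imin, h.2.2.1, anc_refl _, ?_⟩
    by_cases hl : t.anc imin l
    · rwa [← not_anc_of_introduce hop hul hl]
    · exact mem_bag_of_anc_of_not_anc hml hl hxl₂ hxl
  · exact ⟨l₂, hl₂, hml, hxl₂⟩

lemma RespectsAtND.locpw_le [Finite V] (ht : t.IsNicePath) (h : RespectsAtND t C Q imin imax)
    (hC : ∀ i, ∃ v ∈ C, v ∈ t.bag i) {w : ℕ} (hw : ∀ i, (t.bag i).card ≤ w + 1) :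
    locpw G C Q ≤ w := by
  have hsub : ∀ v ∈ Q.XC, v ∈ C := fun v hv => ((h.1.trichotomy v).1).2 (Or.inr (Or.inl hv))
  have key : ∀ i, t.anc imax i → t.anc i imin → ∀ Y : Set V, Y ⊆ ↑(t.bag i) →
      (∀ y ∈ Y, y ∉ C ∧ y ∉ XTRset G C Q) →
      Q.XC.ncard + (XTRset G C Q).ncard + Y.ncard ≤ (t.bag i).card := by
    intro i h₁ h₂ Y hY hY'
    refine card_add_card_add_card_le
      (Set.union_subset (h.XC_subset_XTR_union h₁ h₂) hY) h.disjoint_XC_XTRset ?_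
    rw [Set.disjoint_left]
    rintro y (hy | hy) hyY
    · exact (hY' y hyY).1 (hsub y hy)
    · exact (hY' y hyY).2 hy
  have hL : Q.XC.ncard + (XTRset G C Q).ncard + (XLset G C Q).ncard ≤ w + 1 := by
    refine (key imin h.2.2.1 (anc_refl _) _ (h.XLset_subset ht) fun y hy => ?_).trans (hw _)
    rcases hτ : Q.tauL with u | u | ⟨X, L₁, L₂⟩
    · simp only [XLset, hτ] at hy
      refine ⟨hy.1, fun hy' => ?_⟩
      obtain ⟨z, hyz, hz⟩ := hy'.2.2
      have := h.1.trichotomy z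
      rcases hy.2.1 hyz with hz' | hz'
      · exact this.2.2.1 ⟨hz', hz⟩
      · exact this.2.2.2 ⟨hz', hz⟩
    · simp [XLset, hτ] at hy
    · have hop := h.2.2.2.2.1
      rw [hτ] at hop
      exact absurd hop ht.not_hasOp_join
  have hR : Q.XC.ncard + (XTRset G C Q).ncard + (XRset G C Q).ncard ≤ w + 1 := by
    refine (key imax (anc_refl _) h.2.2.1 _ h.XRset_subset fun y hy => ?_).trans (hw _)
    rcases hτ : Q.tauR with v | v | ⟨X, L₁, L₂⟩
    · simp [XRset, hτ] at hy
    · simp only [XRset, hτ] at hy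
      refine ⟨hy.1, fun hy' => ?_⟩
      obtain ⟨z, hyz, hz⟩ := hy'.2.1
      have := h.1.trichotomy z
      rcases hy.2.1 hyz with hz' | hz'
      · exact this.2.2.1 ⟨hz, hz'⟩
      · exact this.2.1 ⟨hz, hz'⟩
    · simp [XRset, hτ] at hy
  have hE : Q.XC.ncard + (XTRset G C Q).ncard + epsP G C Q ≤ w + 1 := by
    have hmin := key imin h.2.2.1 (anc_refl _) ∅ (Set.empty_subset _) (by simp)
    have hmax := key imax (anc_refl _) h.2.2.1 ∅ (Set.empty_subset _) (by simp)
    rw [Set.ncard_empty] at hmin hmax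
    by_cases hne : (XFPset G C Q).Nonempty
    · rw [epsP, if_pos hne]
      have hop := h.2.2.2.2.1
      rcases hτ : Q.tauL with u | u | ⟨X, L₁, L₂⟩
      · rcases hτ' : Q.tauR with v | v | ⟨X, L₁, L₂⟩
        · rcases h.2.2.2.2.2 with ⟨-, z, -, hz⟩ | ⟨hr, hop'⟩
          · rw [hτ'] at hz
            cases hz
          · have hm : imax ∈ t.children (t.parent imax) := ⟨hr, rfl⟩
            rw [hτ'] at hop'
            rcases hop' with ⟨hc, -⟩ | ⟨j, hc, hv, hb⟩
            · rw [hc] at hm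
              exact hm.elim
            · rw [hc] at hm
              obtain rfl : imax = j := hm
              have := hw (t.parent imax)
              rw [hb, Finset.card_insert_of_notMem hv] at this
              omega
        · obtain ⟨x, hx⟩ := hne
          obtain ⟨i, h₁, h₂, hxi⟩ := h.exists_bag_of_mem_XFPset ht hC hτ hτ' hx
          have := key i h₁ h₂ {x} (by simpa using hxi) (by
            rintro y rfl
            refine ⟨hx.1, fun hy => ?_⟩
            obtain ⟨z, hyz, hz⟩ := hy.2.1
            exact (h.1.trichotomy z).2.1 ⟨hz, hx.2.1 hyz⟩)
          rw [Set.ncard_singleton] at this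
          exact this.trans (hw i)
        · rcases h.2.2.2.2.2 with ⟨-, z, -, hz⟩ | ⟨-, hop'⟩
          · rw [hτ'] at hz
            cases hz
          · rw [hτ'] at hop'
            exact absurd hop' ht.not_hasOp_join
      · rw [hτ] at hop
        obtain ⟨j, -, hu, hb⟩ := hop
        have h₁ := hw j
        have h₂ := Finset.card_erase_add_one hu
        rw [← hb] at h₂
        omega
      · rw [hτ] at hop
        exact absurd hop ht.not_hasOp_join
    · rw [epsP, if_neg hne]
      have := hw imin
      omega
  rw [locpw]
  omega

lemma ppwAux_succ_of_base {m : ℕ} (h : IsBaseQuint C Q) :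
    ppwAux G C (m + 1) Q = locpw G C Q := by
  rw [ppwAux]
  exact if_pos h

lemma ppwAux_succ_of_introduce {m : ℕ} {u : V} (h : ¬ IsBaseQuint C Q)
    (hu : Q.tauL = TDOp.introduce u) :
    ppwAux G C (m + 1) Q = max (locpw G C Q) (sInf {n | ∃ τ,
      ValidQuintP G C ⟨τ, Q.LC, Q.XC \ {u}, Q.RC ∪ {u}, TDOp.introduce u⟩ ∧
      n = ppwAux G C m ⟨τ, Q.LC, Q.XC \ {u}, Q.RC ∪ {u}, TDOp.introduce u⟩}) := by
  rw [ppwAux]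
  refine (if_neg h).trans ?_
  rw [hu]

lemma ppwAux_succ_of_forget {m : ℕ} {u : V} (h : ¬ IsBaseQuint C Q)
    (hu : Q.tauL = TDOp.forget u) :
    ppwAux G C (m + 1) Q = max (locpw G C Q) (sInf {n | ∃ τ,
      ValidQuintP G C ⟨τ, Q.LC \ {u}, Q.XC ∪ {u}, Q.RC, TDOp.forget u⟩ ∧
      n = ppwAux G C m ⟨τ, Q.LC \ {u}, Q.XC ∪ {u}, Q.RC, TDOp.forget u⟩}) := by
  rw [ppwAux]
  refine (if_neg h).trans ?_
  rw [hu]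

lemma ppwAux_succ_le_of_pred {m : ℕ} {Q' : TDQuint V} (h : ¬ IsBaseQuint C Q)
    (hp : IsPredQuint Q' Q) (hv : ValidQuintP G C Q') :
    ppwAux G C (m + 1) Q ≤ max (locpw G C Q) (ppwAux G C m Q') := by
  rcases hp with ⟨u, τ, hu, -, rfl⟩ | ⟨u, τ, hu, -, -, rfl⟩
  · rw [ppwAux_succ_of_introduce h hu]
    exact max_le_max le_rfl (Nat.sInf_le ⟨τ, hv, rfl⟩)
  · rw [ppwAux_succ_of_forget h hu]
    exact max_le_max le_rfl (Nat.sInf_le ⟨τ, hv, rfl⟩)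

lemma exists_pred_ppwAux_le [Finite V] {m : ℕ} (hQ : ValidQuintP G C Q) (h : ¬ IsBaseQuint C Q)
    (hm : 2 * Q.LC.ncard + Q.XC.ncard = m + 1) :
    ∃ Q', IsPredQuint Q' Q ∧ ValidQuintP G C Q' ∧ locpw G C Q ≤ ppwAux G C (m + 1) Q ∧
      ppwAux G C m Q' ≤ ppwAux G C (m + 1) Q := by
  obtain ⟨ι, t, ht, imin, imax, hr⟩ := hQ
  obtain ⟨Q', i, j, hp, hr'⟩ :=
    (hr.base_or_exists_pred ht (nonempty_of_measure_pos hm)).resolve_left h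
  have hv : ValidQuintP G C Q' := ⟨ι, t, ht, i, j, hr'⟩
  rcases hp with ⟨u, τ, hu, huX, rfl⟩ | ⟨u, τ, hu, huL, huX, rfl⟩
  · obtain ⟨τ', hτ', he⟩ := Nat.sInf_mem (s := {n | ∃ τ,
      ValidQuintP G C ⟨τ, Q.LC, Q.XC \ {u}, Q.RC ∪ {u}, TDOp.introduce u⟩ ∧
      n = ppwAux G C m ⟨τ, Q.LC, Q.XC \ {u}, Q.RC ∪ {u}, TDOp.introduce u⟩}) ⟨_, τ, hv, rfl⟩
    refine ⟨_, Or.inl ⟨u, τ', hu, huX, rfl⟩, hτ', ?_, ?_⟩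
    · rw [ppwAux_succ_of_introduce h hu]
      exact le_max_left _ _
    · rw [ppwAux_succ_of_introduce h hu, ← he]
      exact le_max_right _ _
  · obtain ⟨τ', hτ', he⟩ := Nat.sInf_mem (s := {n | ∃ τ,
      ValidQuintP G C ⟨τ, Q.LC \ {u}, Q.XC ∪ {u}, Q.RC, TDOp.forget u⟩ ∧
      n = ppwAux G C m ⟨τ, Q.LC \ {u}, Q.XC ∪ {u}, Q.RC, TDOp.forget u⟩}) ⟨_, τ, hv, rfl⟩
    refine ⟨_, Or.inr ⟨u, τ', hu, huL, huX, rfl⟩, hτ', ?_, ?_⟩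
    · rw [ppwAux_succ_of_forget h hu]
      exact le_max_left _ _
    · rw [ppwAux_succ_of_forget h hu, ← he]
      exact le_max_right _ _

lemma RespectsAtND.ppw_le [Finite V] (ht : t.IsNicePath) (h : RespectsAtND t C Q imin imax)
    (hC : ∀ i, ∃ v ∈ C, v ∈ t.bag i) {w : ℕ} (hw : ∀ i, (t.bag i).card ≤ w + 1) :
    ppw G C Q ≤ w := by
  rw [ppw]
  obtain ⟨m, hm⟩ : ∃ m, 2 * Q.LC.ncard + Q.XC.ncard = m := ⟨_, rfl⟩
  rw [hm]
  induction m generalizing Q imin imax with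
  | zero => exact h.locpw_le ht hC hw
  | succ m ih =>
    by_cases hb : IsBaseQuint C Q
    · rw [ppwAux_succ_of_base hb]
      exact h.locpw_le ht hC hw
    · obtain ⟨Q', i, j, hp, hr⟩ :=
        (h.base_or_exists_pred ht (nonempty_of_measure_pos hm)).resolve_left hb
      refine (ppwAux_succ_le_of_pred hb hp ⟨ι, t, ht, i, j, hr⟩).trans
        (max_le (h.locpw_le ht hC hw) (ih hr ?_))
      have := hp.measure_eq
      omega

lemma ValidQuintP.exists_chain [Finite V] {m : ℕ} (hQ : ValidQuintP G C Q)
    (hm : 2 * Q.LC.ncard + Q.XC.ncard = m + 1) :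
    ∃ (n : ℕ) (q : ℕ → TDQuint V), q n = Q ∧ IsBaseQuint C (q 0) ∧
      (∀ i ≤ n, ValidQuintP G C (q i) ∧ locpw G C (q i) ≤ ppw G C Q) ∧
      ∀ i < n, IsPredQuint (q i) (q (i + 1)) := by
  rw [ppw, hm]
  induction m generalizing Q with
  | zero =>
    by_cases hb : IsBaseQuint C Q
    · refine ⟨0, fun _ => Q, rfl, hb, fun i _ => ⟨hQ, ?_⟩, by simp⟩
      rw [ppwAux_succ_of_base hb]
    · exfalso
      obtain ⟨ι, t, ht, imin, imax, hr⟩ := hQ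
      obtain ⟨Q', i, j, hp, hr'⟩ :=
        (hr.base_or_exists_pred ht (nonempty_of_measure_pos hm)).resolve_left hb
      have hL : Q.LC = ∅ := by
        rw [← Set.ncard_eq_zero]
        omega
      obtain ⟨u, hu⟩ := Set.ncard_eq_one.1 (show Q.XC.ncard = 1 by
        rw [hL, Set.ncard_empty] at hm; omega)
      rcases hp with ⟨v, τ, hv, hvX, -⟩ | ⟨v, τ, -, hvL, -⟩
      · rw [hu] at hvX
        obtain rfl : v = u := hvX
        refine hb ⟨v, hv, hL, hu, ?_⟩
        ext x
        have := hr.1.trichotomy x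
        rw [hL, hu] at this
        simp only [Set.mem_empty_iff_false, Set.mem_singleton_iff] at this
        simp only [Set.mem_sdiff, Set.mem_singleton_iff]
        tauto
      · rw [hL] at hvL
        exact hvL
  | succ m ih =>
    by_cases hb : IsBaseQuint C Q
    · refine ⟨0, fun _ => Q, rfl, hb, fun i _ => ⟨hQ, ?_⟩, by simp⟩
      rw [ppwAux_succ_of_base hb]
    · obtain ⟨Q', hp, hv, hloc, haux⟩ := exists_pred_ppwAux_le hQ hb hm
      obtain ⟨n, q, hq, hq₀, hqv, hqp⟩ := ih hv (by have := hp.measure_eq; omega)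
      refine ⟨n + 1, fun i => if i ≤ n then q i else Q, by simp, by simpa using hq₀, ?_, ?_⟩
      · intro i hi
        by_cases h : i ≤ n
        · simp only [h, if_true]
          exact ⟨(hqv i h).1, (hqv i h).2.trans haux⟩
        · simp only [h, if_false]
          exact ⟨hQ, hloc⟩
      · intro i hi
        by_cases h : i + 1 ≤ n
        · simp only [h, if_true, (show i ≤ n by omega)]
          exact hqp i h
        · obtain rfl : i = n := by omega
          simp only [le_refl, if_true, h, if_false]
          rwa [hq]

end

namespace RootedTreeDecomp

variable {V : Type} {G : SimpleGraph V} {n : ℕ}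

/-- The next node on the path `Fin (n + 1)`; the last node is fixed. -/
def pathParent (n : ℕ) (i : Fin (n + 1)) : Fin (n + 1) :=
  ⟨min (i + 1) n, by omega⟩

lemma pathParent_iterate_val (m : ℕ) (i : Fin (n + 1)) :
    ((pathParent n)^[m] i : ℕ) = min (i + m) n := by
  induction m with
  | zero =>
    have := i.isLt
    simp only [Function.iterate_zero, id_eq]
    omega
  | succ m ih =>
    rw [Function.iterate_succ_apply', pathParent]
    simp only [ih]
    omega

lemma ancestorOf_pathParent {i j : Fin (n + 1)} :
    ancestorOf (pathParent n) i j ↔ j ≤ i := by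
  have hi := i.isLt
  have hj := j.isLt
  constructor
  · rintro ⟨m, rfl⟩
    rw [Fin.le_def, pathParent_iterate_val]
    omega
  · intro h
    rw [Fin.le_def] at h
    refine ⟨i - j, Fin.ext ?_⟩
    rw [pathParent_iterate_val]
    omega

/-- The rooted path decomposition with a given sequence of bags, rooted at the last bag. -/
def ofSeq (b : Fin (n + 1) → Finset V) (cover : ∀ v, ∃ i, v ∈ b i)
    (edge : ∀ u v, G.Adj u v → ∃ i, u ∈ b i ∧ v ∈ b i)
    (conv : ∀ i j k, i ≤ j → j ≤ k → ∀ v, v ∈ b i → v ∈ b k → v ∈ b j) :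
    RootedTreeDecomp V (Fin (n + 1)) G where
  root := Fin.last n
  parent := pathParent n
  parent_root := Fin.ext (by simp [pathParent])
  reaches_root i := ancestorOf_pathParent.2 (Fin.le_last i)
  bag := b
  bag_cover := cover
  bag_edge := edge
  bag_conn := by
    rintro v i j k hi hj ⟨h₁, h₂⟩
    simp only [ancestorOf_pathParent] at h₁ h₂
    rcases le_total i j with hij | hij
    · have := h₂ j hij le_rfl
      refine conv i k j (h₁.elim id fun h => hij.trans h) this v hi hj
    · have := h₂ i le_rfl hij
      exact conv j k i (h₁.elim (fun h => hij.trans h) id) this v hj hi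

end RootedTreeDecomp

lemma exists_equiv_fin_of_key {E : Type} [Fintype E] {n : ℕ} (key : E → ℕ)
    (h : Function.Injective key) (hn : Fintype.card E = n) :
    ∃ σ : E ≃ Fin n, ∀ a b, σ a < σ b ↔ key a < key b := by
  let _ : LinearOrder E := LinearOrder.lift' key h
  let f := (Fintype.orderIsoFinOfCardEq E hn).symm
  exact ⟨f.toEquiv, fun a b => f.lt_iff_lt⟩

lemma PathDecomp.exists_interval {V : Type} {G : SimpleGraph V} {n : ℕ} (d : PathDecomp G n) :
    ∃ l r : V → ℕ, (∀ v, l v ≤ r v) ∧ (∀ u v, G.Adj u v → l u ≤ r v) ∧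
      ∀ (i : ℕ) (v : V), l v ≤ i → i ≤ r v → ∃ hi : i < n, v ∈ d.bag ⟨i, hi⟩ := by
  have hmin : ∀ v, ∃ i, v ∈ d.bag i ∧ ∀ j, v ∈ d.bag j → i ≤ j := fun v => by
    obtain ⟨i, hi, h⟩ := (Finset.univ.filter fun i => v ∈ d.bag i).exists_minimal (by
      obtain ⟨i, hi⟩ := d.bag_cover v
      exact ⟨i, by simpa using hi⟩)
    refine ⟨i, by simpa using hi, fun j hj => ?_⟩
    rcases le_total i j with hij | hij
    · exact hij
    · exact h (by simpa using hj) hij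
  have hmax : ∀ v, ∃ i, v ∈ d.bag i ∧ ∀ j, v ∈ d.bag j → j ≤ i := fun v => by
    obtain ⟨i, hi, h⟩ := (Finset.univ.filter fun i => v ∈ d.bag i).exists_maximal (by
      obtain ⟨i, hi⟩ := d.bag_cover v
      exact ⟨i, by simpa using hi⟩)
    refine ⟨i, by simpa using hi, fun j hj => ?_⟩
    rcases le_total i j with hij | hij
    · exact h (by simpa using hj) hij
    · exact hij
  choose l hl hl' using hmin
  choose r hr hr' using hmax
  refine ⟨fun v => l v, fun v => r v, fun v => hl' v _ (hr v), fun u v huv => ?_, ?_⟩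
  · obtain ⟨i, hu, hv⟩ := d.bag_edge u v huv
    exact (hl' u i hu).trans (hr' v i hv)
  · intro i v h₁ h₂
    have hi : i < n := h₂.trans_lt (r v).isLt
    exact ⟨hi, d.bag_conv (l v) ⟨i, hi⟩ (r v) h₁ h₂ v (hl v) (hr v)⟩

section

open RootedTreeDecomp

variable {V : Type} [Fintype V] [DecidableEq V] {G : SimpleGraph V}

/-- A bijective schedule of introduce and forget events, given by the equivalence `σ` (`inl` for
introduce, `inr` for forget), yields a nice path decomposition. -/
lemma exists_isNicePath_of_schedule {n : ℕ} (σ : V ⊕ V ≃ Fin (n + 2)) (z : V)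
    (hz : (σ (Sum.inl z) : ℕ) = 0) (hz' : (σ (Sum.inr z) : ℕ) = n + 1)
    (hlt : ∀ v, σ (Sum.inl v) < σ (Sum.inr v))
    (hadj : ∀ u v, G.Adj u v → σ (Sum.inl u) < σ (Sum.inr v)) :
    ∃ t : RootedTreeDecomp V (Fin (n + 1)) G, t.IsNicePath ∧ t.bag t.root = {z} ∧
      ∀ i v, v ∈ t.bag i ↔ (σ (Sum.inl v) : ℕ) ≤ i ∧ (i : ℕ) < σ (Sum.inr v) := by
  have hI : ∀ u v, (σ (Sum.inl u) : ℕ) = σ (Sum.inl v) → u = v := fun u v h =>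
    Sum.inl_injective (σ.injective (Fin.ext h))
  have hF : ∀ u v, (σ (Sum.inr u) : ℕ) = σ (Sum.inr v) → u = v := fun u v h =>
    Sum.inr_injective (σ.injective (Fin.ext h))
  have hIF : ∀ u v, (σ (Sum.inl u) : ℕ) ≠ σ (Sum.inr v) := fun u v h =>
    Sum.inl_ne_inr (σ.injective (Fin.ext h))
  simp only [Fin.lt_def] at hlt hadj
  let b : Fin (n + 1) → Finset V := fun i =>
    Finset.univ.filter fun v => (σ (Sum.inl v) : ℕ) ≤ i ∧ (i : ℕ) < σ (Sum.inr v)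
  have hb : ∀ i v, v ∈ b i ↔ (σ (Sum.inl v) : ℕ) ≤ i ∧ (i : ℕ) < σ (Sum.inr v) := fun i v => by
    simp [b]
  have hlast : ∀ e, (σ e : ℕ) < n + 2 := fun e => (σ e).isLt
  let t : RootedTreeDecomp V (Fin (n + 1)) G := ofSeq b
    (fun v => ⟨⟨σ (Sum.inl v), by have := hlt v; have := hlast (Sum.inr v); omega⟩,
      (hb _ _).2 ⟨le_rfl, hlt v⟩⟩)
    (fun u v huv => by
      have h₁ := hlt u
      have h₂ := hlt v
      have h₃ := hadj u v huv
      have h₄ := hadj v u huv.symm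
      have h₅ := hlast (Sum.inr u)
      refine ⟨⟨max (σ (Sum.inl u)) (σ (Sum.inl v)), by omega⟩, (hb _ _).2 ?_, (hb _ _).2 ?_⟩ <;>
      · simp only
        omega)
    (fun i j k hij hjk v hi hk => by
      rw [hb] at *
      rw [Fin.le_def] at *
      omega)
  have hchild : ∀ (i : Fin (n + 1)) (j : Fin (n + 1)), j ∈ t.children i ↔ (j : ℕ) + 1 = i := by
    intro i j
    have hi := i.isLt
    have hj := j.isLt
    change (j ≠ Fin.last n ∧ pathParent n j = i) ↔ _
    rw [ne_eq, Fin.ext_iff, Fin.ext_iff, pathParent, Fin.val_last]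
    simp only
    omega
  refine ⟨t, fun i => ?_, ?_, hb⟩
  · have hi := i.isLt
    rcases Nat.eq_zero_or_pos i with h0 | hpos
    · left
      refine ⟨?_, z, ?_⟩
      · ext j
        rw [hchild]
        simp [h0]
      · ext v
        change v ∈ b i ↔ _
        rw [hb, Finset.mem_singleton]
        constructor
        · rintro ⟨h, -⟩
          exact hI _ _ (by omega)
        · rintro rfl
          omega
    · right
      let j : Fin (n + 1) := ⟨i - 1, by omega⟩
      have hj : (j : ℕ) + 1 = i := by simp only [j]; omega
      have hc : t.children i = {j} := by
        ext k
        rw [hchild, Set.mem_singleton_iff, Fin.ext_iff]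
        omega
      obtain ⟨e, he⟩ := σ.surjective ⟨i, by omega⟩
      rw [Fin.ext_iff] at he
      simp only at he
      rcases e with v | v
      · left
        refine ⟨j, v, hc, ?_, ?_⟩
        · change v ∉ b j
          rw [hb]
          omega
        · ext w
          change w ∈ b i ↔ w ∈ insert v (b j)
          rw [Finset.mem_insert, hb, hb]
          by_cases hw : w = v
          · subst hw
            have := hlt w
            simp only [true_or, iff_true]
            omega
          · have h₁ : (σ (Sum.inl w) : ℕ) ≠ σ (Sum.inl v) := fun h => hw (hI w v h)
            have h₂ := hIF v w
            simp only [hw, false_or]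
            omega
      · right
        refine ⟨j, v, hc, ?_, ?_⟩
        · change v ∈ b j
          have := hlt v
          rw [hb]
          omega
        · ext w
          change w ∈ b i ↔ w ∈ (b j).erase v
          rw [Finset.mem_erase, hb, hb]
          by_cases hw : w = v
          · subst hw
            simp only [ne_eq, not_true_eq_false, false_and, iff_false]
            omega
          · have h₁ : (σ (Sum.inr w) : ℕ) ≠ σ (Sum.inr v) := fun h => hw (hF w v h)
            have h₂ := hIF w v
            simp only [ne_eq, hw, not_false_eq_true, true_and]
            omega
  · ext v
    change v ∈ b (Fin.last n) ↔ _
    rw [hb, Finset.mem_singleton, Fin.val_last]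
    constructor
    · rintro ⟨-, h⟩
      have := hlast (Sum.inr v)
      exact hF _ _ (by omega)
    · rintro rfl
      omega

lemma PathDecomp.exists_isNicePath {N : ℕ} (d : PathDecomp G N) {z : V}
    (hz : ∀ v, v ≠ z → G.Adj z v) :
    ∃ (n : ℕ) (t : RootedTreeDecomp V (Fin (n + 1)) G), t.IsNicePath ∧ t.bag t.root = {z} ∧
      (∀ i, z ∈ t.bag i) ∧ ∀ i, (t.bag i).card ≤ d.width + 1 := by
  obtain ⟨l, r, hlr, hadj, hbag⟩ := d.exists_interval
  obtain ⟨k, hk⟩ : ∃ k, Fintype.card V = k + 1 :=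
    Nat.exists_eq_succ_of_ne_zero (Fintype.card_pos_iff.2 ⟨z⟩).ne'
  obtain ⟨e, hez⟩ : ∃ e : V ≃ Fin (k + 1), e z = 0 := by
    let e₀ := Fintype.equivFinOfCardEq hk
    exact ⟨e₀.trans (Equiv.swap (e₀ z) 0), by simp⟩
  have hez : (e z : ℕ) = 0 := by rw [hez]; rfl
  have he : ∀ v, (e v : ℕ) < k + 1 := fun v => (e v).isLt
  let l' : V → ℕ := fun v => max (l v) (l z)
  let r' : V → ℕ := fun v => min (r v) (r z)
  have hzadj : ∀ v, l v ≤ r z ∧ l z ≤ r v := fun v => by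
    by_cases hv : v = z
    · subst hv
      exact ⟨hlr v, hlr v⟩
    · exact ⟨hadj _ _ (hz v hv).symm, hadj _ _ (hz v hv)⟩
  obtain ⟨M, hM⟩ : ∃ M, M = 2 * (k + 1) := ⟨_, rfl⟩
  have hMpos : 0 < M := by omega
  let key : V ⊕ V → ℕ := Sum.elim (fun v => M * l' v + e v) fun v => M * r' v + (M - 1 - e v)
  have hdiv : ∀ a c, c < M → (M * a + c) / M = a ∧ (M * a + c) % M = c := fun a c hc =>
    ⟨by rw [Nat.mul_add_div hMpos, Nat.div_eq_of_lt hc, add_zero],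
      by rw [Nat.mul_add_mod, Nat.mod_eq_of_lt hc]⟩
  have hkl : ∀ v, key (Sum.inl v) / M = l' v ∧ key (Sum.inl v) % M = e v := fun v =>
    hdiv _ _ (by have := he v; omega)
  have hkr : ∀ v, key (Sum.inr v) / M = r' v ∧ key (Sum.inr v) % M = M - 1 - e v := fun v =>
    hdiv _ _ (by omega)
  have hkey : Function.Injective key := by
    rintro (u | u) (v | v) h
    · have := (hkl u).2.symm.trans ((congrArg (· % M) h).trans (hkl v).2)
      rw [e.injective (Fin.ext this)]
    · have := (hkl u).2.symm.trans ((congrArg (· % M) h).trans (hkr v).2)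
      have := he u
      have := he v
      omega
    · have := (hkr u).2.symm.trans ((congrArg (· % M) h).trans (hkl v).2)
      have := he u
      have := he v
      omega
    · have := (hkr u).2.symm.trans ((congrArg (· % M) h).trans (hkr v).2)
      have h₁ := he u
      have h₂ := he v
      rw [e.injective (Fin.ext (show (e u : ℕ) = e v by omega))]
  obtain ⟨σ, hσ⟩ := exists_equiv_fin_of_key (n := 2 * k + 2) key hkey (by
    rw [Fintype.card_sum, hk]; ring)
  have hmul : ∀ {a c : ℕ}, a ≤ c → M * a ≤ M * c := fun h => Nat.mul_le_mul_left M h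
  have hlt : ∀ u v, l' u ≤ r' v → σ (Sum.inl u) < σ (Sum.inr v) := fun u v h => by
    rw [hσ]
    have h₁ := hmul h
    have h₂ := he u
    have h₃ := he v
    simp only [key, Sum.elim_inl, Sum.elim_inr]
    omega
  have hlr' : ∀ v, l' v ≤ r' v := fun v =>
    max_le (le_min (hlr v) (hzadj v).1) (le_min (hzadj v).2 (hlr z))
  have hz0 : ∀ x, key (Sum.inl z) ≤ key x := by
    rintro (v | v)
    · have h₁ : M * l' z ≤ M * l' v := hmul (by simp [l'])
      simp only [key, Sum.elim_inl]
      omega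
    · have h₁ : M * l' z ≤ M * r' v := hmul ((show l' z ≤ l' v by simp [l']).trans (hlr' v))
      simp only [key, Sum.elim_inl, Sum.elim_inr]
      omega
  have hz1 : ∀ x, key x ≤ key (Sum.inr z) := by
    rintro (v | v)
    · have h₁ : M * l' v ≤ M * r' z := hmul ((hlr' v).trans (show r' v ≤ r' z by simp [r']))
      have := he v
      simp only [key, Sum.elim_inl, Sum.elim_inr]
      omega
    · have h₁ : M * r' v ≤ M * r' z := hmul (by simp [r'])
      simp only [key, Sum.elim_inr]
      omega
  have hσle : ∀ a b, σ a ≤ σ b ↔ key a ≤ key b := fun a b => by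
    rw [← not_lt, ← not_lt, hσ]
  have hσ0 : (σ (Sum.inl z) : ℕ) = 0 := by
    obtain ⟨x, hx⟩ := σ.surjective 0
    have := (hσle _ _).2 (hz0 x)
    rw [hx, Fin.le_def, Fin.val_zero] at this
    omega
  have hσ1 : (σ (Sum.inr z) : ℕ) = 2 * k + 1 := by
    obtain ⟨x, hx⟩ := σ.surjective (Fin.last (2 * k + 1))
    have := (hσle _ _).2 (hz1 x)
    rw [hx, Fin.le_def, Fin.val_last] at this
    have := (σ (Sum.inr z)).isLt
    omega
  obtain ⟨t, ht, hroot, hmem⟩ := exists_isNicePath_of_schedule (G := G) (n := 2 * k) σ z hσ0 hσ1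
    (fun v => hlt v v (hlr' v)) (fun u v huv => hlt u v
      (max_le (le_min (hadj u v huv) (hzadj u).1) (le_min (hzadj v).2 (hlr z))))
  have hzt : ∀ i, z ∈ t.bag i := fun i => (hmem i z).2 (by have := i.isLt; omega)
  refine ⟨2 * k, t, ht, hroot, hzt, fun i => ?_⟩
  obtain ⟨x, hx⟩ := σ.surjective ⟨i, by omega⟩
  have hxi : (σ x : ℕ) = i := by rw [hx]
  have hdm : ∀ v ∈ t.bag i, l v ≤ key x / M ∧ key x / M ≤ r v := fun v hv => by
    obtain ⟨h₁, h₂⟩ := (hmem i v).1 hv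
    rw [← hxi, ← Fin.le_def, hσle] at h₁
    rw [← hxi, ← Fin.lt_def, hσ] at h₂
    have h₃ := Nat.div_le_div_right (c := M) h₁
    have h₄ := Nat.div_le_div_right (c := M) h₂.le
    rw [(hkl v).1] at h₃
    rw [(hkr v).1] at h₄
    exact ⟨(le_max_left _ _).trans h₃, h₄.trans (min_le_left _ _)⟩
  obtain ⟨hN, -⟩ := hbag _ z (hdm z (hzt i)).1 (hdm z (hzt i)).2
  have hsub : t.bag i ⊆ d.bag ⟨key x / M, hN⟩ := fun v hv =>
    (hbag _ v (hdm v hv).1 (hdm v hv).2).2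
  have h₁ := Finset.card_le_card hsub
  have h₂ := Finset.le_sup (f := fun i => (d.bag i).card) (Finset.mem_univ ⟨key x / M, hN⟩)
  rw [PathDecomp.width]
  omega

end

lemma pathwidth_le_width {V : Type} {G : SimpleGraph V} {N : ℕ} (d : PathDecomp G N) :
    pathwidth G ≤ d.width :=
  Nat.sInf_le ⟨N, d, le_rfl⟩

lemma exists_pathDecomp_width_eq_pathwidth {V : Type} [Fintype V] (G : SimpleGraph V) :
    ∃ (N : ℕ) (d : PathDecomp G N), d.width ≤ pathwidth G := by
  let d : PathDecomp G 1 :=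
    { bag := fun _ => Finset.univ
      bag_cover := fun v => ⟨0, Finset.mem_univ v⟩
      bag_edge := fun u v _ => ⟨0, Finset.mem_univ u, Finset.mem_univ v⟩
      bag_conv := fun _ _ _ _ _ v _ _ => Finset.mem_univ v }
  exact Nat.sInf_mem (s := {w | ∃ (n : ℕ) (d : PathDecomp G n), d.width ≤ w})
    ⟨d.width, 1, d, le_rfl⟩

/-- An interval model of a supergraph of `G` in which every point is covered at most `w + 1` times
bounds the pathwidth. -/
lemma pathwidth_le_of_interval {V : Type} [Fintype V] {G : SimpleGraph V} {N w : ℕ} {l r : V → ℕ}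
    (hlr : ∀ v, l v ≤ r v) (hr : ∀ v, r v < N) (hadj : ∀ u v, G.Adj u v → l u ≤ r v)
    (hw : ∀ p < N, {v | l v ≤ p ∧ p ≤ r v}.ncard ≤ w + 1) : pathwidth G ≤ w := by
  let d : PathDecomp G N :=
    { bag := fun p => Finset.univ.filter fun v => l v ≤ p ∧ (p : ℕ) ≤ r v
      bag_cover := fun v => ⟨⟨r v, hr v⟩, by simp [hlr v]⟩
      bag_edge := fun u v huv => by
        refine ⟨⟨max (l u) (l v),
          max_lt ((hlr u).trans_lt (hr u)) ((hlr v).trans_lt (hr v))⟩, ?_, ?_⟩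
        · simp [hlr u, hadj v u huv.symm]
        · simp [hlr v, hadj u v huv]
      bag_conv := fun i j k hij hjk v hi hk => by
        simp only [Finset.mem_filter, Finset.mem_univ, true_and] at hi hk ⊢
        rw [Fin.le_def] at hij hjk
        omega }
  refine (pathwidth_le_width d).trans ?_
  have h : (Finset.univ.sup fun p => (d.bag p).card) ≤ w + 1 := Finset.sup_le fun p _ => by
    have := hw p p.isLt
    rwa [Set.ncard_eq_toFinset_card', Set.toFinset_ofPred] at this
  rw [PathDecomp.width]
  omega

lemma exists_threshold {P : ℕ → Prop} {n : ℕ} (hn : P n) (hs : ∀ i < n, P i → P (i + 1)) :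
    ∃ b ≤ n, ∀ i ≤ n, P i ↔ b ≤ i := by
  refine ⟨Nat.find ⟨n, hn⟩, Nat.find_min' _ hn, fun i hi => ⟨fun h => Nat.find_min' _ h, fun h => ?_⟩⟩
  induction i, h using Nat.le_induction with
  | base => exact Nat.find_spec ⟨n, hn⟩
  | succ k hk ih => exact hs k hi (ih (by omega))

lemma IsPredQuint.tauR_eq {V : Type} {Q Q' : TDQuint V} (h : IsPredQuint Q' Q) :
    Q'.tauR = Q.tauL := by
  rcases h with ⟨u, τ, h, -, rfl⟩ | ⟨u, τ, h, -, -, rfl⟩ <;> exact h.symm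

lemma IsPredQuint.RC_subset {V : Type} {Q Q' : TDQuint V} (h : IsPredQuint Q' Q) :
    Q.RC ⊆ Q'.RC := by
  rcases h with ⟨u, τ, h, -, rfl⟩ | ⟨u, τ, h, -, -, rfl⟩
  · exact Set.subset_union_left
  · exact subset_rfl

lemma IsPredQuint.LC_subset {V : Type} {Q Q' : TDQuint V} (h : IsPredQuint Q' Q) :
    Q'.LC ⊆ Q.LC := by
  rcases h with ⟨u, τ, h, -, rfl⟩ | ⟨u, τ, h, -, -, rfl⟩
  · exact subset_rfl
  · exact Set.sdiff_subset

lemma IsPredQuint.tauL_of_mem_RC {V : Type} {Q Q' : TDQuint V} (h : IsPredQuint Q' Q) {c : V}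
    (hc : c ∉ Q.RC) (hc' : c ∈ Q'.RC) : Q.tauL = TDOp.introduce c := by
  rcases h with ⟨u, τ, h, -, rfl⟩ | ⟨u, τ, h, -, -, rfl⟩
  · rcases hc' with hc' | rfl
    · exact absurd hc' hc
    · exact h
  · exact absurd hc' hc

lemma IsPredQuint.tauL_of_mem_LC {V : Type} {Q Q' : TDQuint V} (h : IsPredQuint Q' Q) {c : V}
    (hc : c ∈ Q.LC) (hc' : c ∉ Q'.LC) : Q.tauL = TDOp.forget c := by
  rcases h with ⟨u, τ, h, -, rfl⟩ | ⟨u, τ, h, -, -, rfl⟩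
  · exact absurd hc hc'
  · have : c = u := by
      by_contra hne
      exact hc' ⟨hc, hne⟩
    rw [this]
    exact h

lemma ValidQuintP.trichotomy {V : Type} [DecidableEq V] {G : SimpleGraph V} {C : Set V}
    {Q : TDQuint V} (h : ValidQuintP G C Q) (v : V) :
    (v ∈ C ↔ v ∈ Q.LC ∨ v ∈ Q.XC ∨ v ∈ Q.RC) ∧ ¬ (v ∈ Q.LC ∧ v ∈ Q.XC) ∧
      ¬ (v ∈ Q.LC ∧ v ∈ Q.RC) ∧ ¬ (v ∈ Q.XC ∧ v ∈ Q.RC) := by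
  obtain ⟨ι, t, -, imin, imax, h⟩ := h
  exact h.1.trichotomy v

lemma ValidQuintP.not_adj {V : Type} [DecidableEq V] {G : SimpleGraph V} {C : Set V}
    {Q : TDQuint V} (h : ValidQuintP G C Q) {y z : V} (hy : y ∈ Q.LC) (hz : z ∈ Q.RC) :
    ¬ G.Adj y z := by
  obtain ⟨ι, t, -, imin, imax, h⟩ := h
  rw [h.1.1] at hy
  rw [h.1.2.2] at hz
  exact RootedTreeDecomp.not_adj_Lset_Rset hy.1 hz.1

/-- `b` and `e` give the first and the last index at which a vertex of `C` lies in the bag trace of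
the chain of quintuples `q 0, …, q n`. -/
structure IsChainTimes {V : Type} (C : Set V) (n : ℕ) (q : ℕ → TDQuint V) (b e : V → ℕ) : Prop where
  le : ∀ c ∈ C, b c ≤ e c
  le_last : ∀ c ∈ C, e c ≤ n
  mem_LC : ∀ c ∈ C, ∀ i ≤ n, c ∈ (q i).LC ↔ e c < i
  mem_RC : ∀ c ∈ C, ∀ i ≤ n, c ∈ (q i).RC ↔ i < b c
  mem_XC : ∀ c ∈ C, ∀ i ≤ n, c ∈ (q i).XC ↔ b c ≤ i ∧ i ≤ e c
  tauL : ∀ c ∈ C, (q (b c)).tauL = TDOp.introduce c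
  tauR : ∀ c ∈ C, (q (e c)).tauR = TDOp.forget c

section

variable {V : Type} {G : SimpleGraph V} {C : Set V} {n : ℕ} {q : ℕ → TDQuint V}
  {b e : V → ℕ}

lemma exists_isChainTimes [DecidableEq V] {z : V} (h₀ : IsBaseQuint C (q 0))
    (hL : (q n).LC = C \ {z}) (hR : (q n).RC = ∅) (hτ : (q n).tauR = TDOp.forget z)
    (hv : ∀ i ≤ n, ValidQuintP G C (q i)) (hp : ∀ i < n, IsPredQuint (q i) (q (i + 1))) :
    ∃ b e, IsChainTimes C n q b e := by
  obtain ⟨u₀, hu₀, hL₀, -, hR₀⟩ := h₀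
  have hb : ∀ c, ∃ b ≤ n, ∀ i ≤ n, c ∉ (q i).RC ↔ b ≤ i := fun c =>
    exists_threshold (P := fun i => c ∉ (q i).RC) (by simp [hR])
      fun i hi h h' => h ((hp i hi).RC_subset h')
  have he : ∀ c, ∃ e ≤ n, ∀ i ≤ n, c ∈ (q i).LC ↔ e < i := fun c => by
    obtain ⟨b, hb, h⟩ := exists_threshold (P := fun i => n < i ∨ c ∈ (q i).LC) (n := n + 1)
      (Or.inl n.lt_succ_self) fun i hi h => by
        rcases Nat.lt_succ_iff_lt_or_eq.1 hi with hi | rfl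
        · exact Or.inr ((hp i hi).LC_subset (h.resolve_left (by omega)))
        · exact Or.inl i.lt_succ_self
    have h0 := (h 0 (by omega)).not
    simp only [hL₀, Set.mem_empty_iff_false, or_false, not_lt, Nat.zero_le, true_iff] at h0
    refine ⟨b - 1, by omega, fun i hi => ?_⟩
    have := h i (by omega)
    rw [or_iff_right (by omega)] at this
    rw [this]
    omega
  choose b hbn hb using hb
  choose e hen he using he
  have hb' : ∀ c, ∀ i ≤ n, c ∈ (q i).RC ↔ i < b c := fun c i hi => by
    rw [← not_le, ← hb c i hi, not_not]
  have hX : ∀ c ∈ C, ∀ i ≤ n, c ∈ (q i).XC ↔ b c ≤ i ∧ i ≤ e c := fun c hc i hi => by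
    have h₁ := (hv i hi).trichotomy c
    have h₂ := hb c i hi
    have h₃ := (he c i hi).not
    rw [not_lt] at h₃
    rw [← h₂, ← h₃]
    tauto
  refine ⟨b, e, fun c hc => ?_, fun c _ => hen c, fun c _ => he c, fun c _ => hb' c, hX,
    fun c hc => ?_, fun c hc => ?_⟩
  · by_contra! hlt
    have h₁ := (he c (b c) (hbn c)).2 hlt
    obtain ⟨k, hk⟩ := Nat.exists_eq_succ_of_ne_zero (show b c ≠ 0 by omega)
    have hkn : k < n := by have := hbn c; omega
    have h₂ := (hb' c k hkn.le).2 (by omega)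
    have h₃ := (hb c (b c) (hbn c)).2 le_rfl
    rw [hk] at h₁ h₃
    have h₄ := (hp k hkn).tauL_of_mem_RC h₃ h₂
    have h₅ := (hp k hkn).tauL_of_mem_LC h₁ fun h => ((hv k hkn.le).trichotomy c).2.2.1 ⟨h, h₂⟩
    rw [h₄] at h₅
    cases h₅
  · have h₁ := (hb c (b c) (hbn c)).2 le_rfl
    rcases Nat.eq_zero_or_pos (b c) with h0 | hpos
    · rw [h0, hR₀] at h₁
      have : c = u₀ := by
        by_contra hne
        exact h₁ ⟨hc, hne⟩
      rw [h0, hu₀, this]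
    · obtain ⟨k, hk⟩ := Nat.exists_eq_succ_of_ne_zero hpos.ne'
      have hkn : k < n := by have := hbn c; omega
      have h₂ := (hb' c k hkn.le).2 (by omega)
      rw [hk] at h₁ ⊢
      exact (hp k hkn).tauL_of_mem_RC h₁ h₂
  · have h₁ : c ∉ (q (e c)).LC := fun h => ((he c _ (hen c)).1 h).false
    rcases (hen c).eq_or_lt with hn | hlt
    · rw [hn, hL] at h₁
      have : c = z := by
        by_contra hne
        exact h₁ ⟨hc, hne⟩
      rw [hn, hτ, this]
    · rw [(hp _ hlt).tauR_eq]
      exact (hp _ hlt).tauL_of_mem_LC ((he c _ hlt).2 (Nat.lt_succ_self _)) h₁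

lemma IsChainTimes.le_of_adj [DecidableEq V] (h : IsChainTimes C n q b e) (hv : ∀ i ≤ n, ValidQuintP G C (q i))
    (hp : ∀ i < n, IsPredQuint (q i) (q (i + 1))) {x y : V} (hx : x ∈ C) (hy : y ∈ C)
    (hxy : G.Adj x y) : b x ≤ e y := by
  by_contra! hlt
  have hn : b x ≤ n := (h.le x hx).trans (h.le_last x hx)
  rcases Nat.succ_le_iff.2 hlt |>.eq_or_lt with heq | hlt'
  · have h₁ := (hp (e y) (by omega)).tauR_eq
    rw [h.tauR y hy, ← Nat.succ_eq_add_one, heq, h.tauL x hx] at h₁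
    cases h₁
  · have hi : e y + 1 ≤ n := by omega
    exact (hv _ hi).not_adj ((h.mem_LC y hy _ hi).2 (Nat.lt_succ_self _))
      ((h.mem_RC x hx _ hi).2 hlt') hxy.symm

lemma IsChainTimes.exists_mem_XFPset [Finite V] (h : IsChainTimes C n q b e)
    (hp : ∀ i < n, IsPredQuint (q i) (q (i + 1))) {x y z : V} (hx : x ∉ C)
    (hN : G.neighborSet x ⊆ C) (hy : G.Adj x y) (hye : ∀ c, G.Adj x c → e y ≤ e c)
    (hz : G.Adj x z) (hzb : ∀ c, G.Adj x c → b c ≤ b z) (hzy : b z ≤ e y) :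
    ∃ i, b z ≤ i ∧ i ≤ e y ∧ x ∈ XFPset G C (q i) := by
  obtain ⟨i, hi, hmin⟩ := (Finset.Icc (b z) (e y)).exists_min_image (fun i => (q i).XC.ncard)
    ⟨b z, Finset.mem_Icc.2 ⟨le_rfl, hzy⟩⟩
  simp only [Finset.mem_Icc, and_imp] at hi hmin
  have hyn := h.le_last y (hN hy)
  have hNX : G.neighborSet x ⊆ (q i).XC := fun c hc =>
    (h.mem_XC c (hN hc) i (by omega)).2 ⟨(hzb c hc).trans hi.1, hi.2.trans (hye c hc)⟩
  refine ⟨i, hi.1, hi.2, hx, hNX, fun hss hsub => ?_, fun hss hsub => ?_⟩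
  · unfold XCminus at hss hsub
    rcases hτ : (q i).tauL with u | u | ⟨X, L₁, L₂⟩ <;> simp only [hτ] at hss hsub
    · rcases hi.1.eq_or_lt with heq | hlt
      · have h₁ := h.tauL z (hN hz)
        rw [heq, hτ] at h₁
        cases h₁
        exact (hsub hz).2 rfl
      · obtain ⟨k, rfl⟩ := Nat.exists_eq_succ_of_ne_zero (show i ≠ 0 by omega)
        have h₁ := hmin k (by omega) (by omega)
        rcases hp k (by omega) with ⟨v, τ, hv, -, hq⟩ | ⟨v, τ, hv, -, -, hq⟩
        · have h₂ := Set.ncard_lt_ncard hss (Set.toFinite _)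
          rw [Nat.succ_eq_add_one, hv] at hτ
          cases hτ
          rw [hq] at h₁
          simp only [Nat.succ_eq_add_one] at h₁ h₂
          omega
        · rw [Nat.succ_eq_add_one, hv] at hτ
          cases hτ
    · exact hss.2 Set.subset_union_left
    · exact hss.2 subset_rfl
  · unfold XCplus at hss hsub
    rcases hτ : (q i).tauR with u | u | ⟨X, L₁, L₂⟩ <;> simp only [hτ] at hss hsub
    · exact hss.2 Set.subset_union_left
    · rcases hi.2.eq_or_lt with heq | hlt
      · have h₁ := h.tauR y (hN hy)
        rw [← heq, hτ] at h₁
        cases h₁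
        exact (hsub hy).2 rfl
      · have h₁ := hmin (i + 1) (by omega) (by omega)
        rcases hp i (by omega) with ⟨v, τ, hv, -, hq⟩ | ⟨v, τ, hv, -, hvX, hq⟩
        · rw [hq] at hτ
          cases hτ
        · rw [hq] at h₁
          simp only at h₁
          rw [Set.union_singleton, Set.ncard_insert_of_notMem hvX (Set.toFinite _)] at h₁
          omega
    · exact hss.2 subset_rfl

end

/-- The interval of a vertex in the path decomposition assembled from a chain of quintuples, where
each index of the chain is blown up into `M` consecutive bags: vertices of `C` occupy whole blocks,
a vertex outside `C` either joins its neighbours' blocks or gets a private bag. -/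
lemma IsChainTimes.exists_interval {V : Type} [Finite V] {G : SimpleGraph V} {C : Set V} {n : ℕ}
    {q : ℕ → TDQuint V} {b e : V → ℕ} (h : IsChainTimes C n q b e)
    (hp : ∀ i < n, IsPredQuint (q i) (q (i + 1))) (M : ℕ) {x : V} (idx : ℕ) (hM : idx + 2 < M)
    (hx : x ∉ C) (hN : G.neighborSet x ⊆ C) (hne : (G.neighborSet x).Nonempty) :
    ∃ l r, l ≤ r ∧ r < M * n + M ∧
      (∀ c, G.Adj x c → l ≤ M * e c + (M - 1) ∧ M * b c ≤ r) ∧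
      ∀ i j, j < M → l ≤ M * i + j → M * i + j ≤ r → x ∈ XTRset G C (q i) ∨
        (j = 0 ∧ x ∈ XLset G C (q i)) ∨ (j = M - 1 ∧ x ∈ XRset G C (q i)) ∨
        (j = idx + 1 ∧ x ∈ XFPset G C (q i)) := by
  have hmul : ∀ {a c : ℕ}, a ≤ c → M * a ≤ M * c := fun h => Nat.mul_le_mul_left M h
  have hlt : ∀ {a c : ℕ}, a < c → M * a + M ≤ M * c := fun h => Nat.mul_le_mul_left M h
  obtain ⟨y, hy, hye⟩ := (G.neighborSet x).toFinite.exists_minimalFor e _ hne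
  obtain ⟨z, hz, hzb⟩ := (G.neighborSet x).toFinite.exists_maximalFor b _ hne
  replace hye : ∀ c, G.Adj x c → e y ≤ e c := fun c hc =>
    (le_total (e y) (e c)).elim id (hye hc)
  replace hzb : ∀ c, G.Adj x c → b c ≤ b z := fun c hc =>
    (le_total (b c) (b z)).elim id (hzb hc)
  have hyn := h.le_last y (hN hy)
  have hzn := (h.le z (hN hz)).trans (h.le_last z (hN hz))
  rcases lt_or_ge (e y) (b z) with hyz | hzy
  · refine ⟨M * e y + (M - 1), M * b z, ?_, ?_, fun c hc => ⟨?_, hmul (hzb c hc)⟩, ?_⟩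
    · have := hlt hyz
      omega
    · have := hmul hzn
      omega
    · have := hmul (hye c hc)
      omega
    · intro i j hj hl hr
      have hyi : e y ≤ i := by
        by_contra! hn
        have := hlt hn
        omega
      have hiz : i ≤ b z := by
        by_contra! hn
        have := hlt hn
        omega
      have hin : i ≤ n := hiz.trans hzn
      have hL : e y < i → (G.neighborSet x ∩ (q i).LC).Nonempty := fun hlt =>
        ⟨y, hy, (h.mem_LC y (hN hy) i hin).2 hlt⟩
      have hR : i < b z → (G.neighborSet x ∩ (q i).RC).Nonempty := fun hlt =>
        ⟨z, hz, (h.mem_RC z (hN hz) i hin).2 hlt⟩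
      rcases hyi.eq_or_lt with rfl | hyi
      · right; right; left
        refine ⟨by omega, ?_⟩
        unfold XRset
        rw [h.tauR y (hN hy)]
        refine ⟨hx, fun c hc => ?_, hy, hR hyz⟩
        have h₁ := h.mem_RC c (hN hc) (e y) hin
        have h₂ := h.mem_XC c (hN hc) (e y) hin
        have h₃ := hye c hc
        rw [Set.mem_union, h₁, h₂]
        omega
      · rcases hiz.eq_or_lt with rfl | hiz
        · right; left
          refine ⟨by omega, ?_⟩
          unfold XLset
          rw [h.tauL z (hN hz)]
          refine ⟨hx, fun c hc => ?_, hz, hL hyz⟩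
          have h₁ := h.mem_LC c (hN hc) (b z) hin
          have h₂ := h.mem_XC c (hN hc) (b z) hin
          have h₃ := hzb c hc
          rw [Set.mem_union, h₁, h₂]
          omega
        · exact Or.inl ⟨hx, hL hyi, hR hiz⟩
  · obtain ⟨k, hzk, hky, hk⟩ := h.exists_mem_XFPset hp hx hN hy hye hz hzb hzy
    refine ⟨M * k + (idx + 1), M * k + (idx + 1), le_rfl, ?_, fun c hc => ⟨?_, ?_⟩, ?_⟩
    · have := hmul (hky.trans hyn)
      omega
    · have := hmul (hky.trans (hye c hc))
      omega
    · have := hmul ((hzb c hc).trans hzk)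
      omega
    · intro i j hj hl hr
      have hik : i = k := by
        rcases lt_trichotomy i k with hn | hn | hn
        · have := hlt hn
          omega
        · exact hn
        · have := hlt hn
          omega
      subst hik
      exact Or.inr (Or.inr (Or.inr ⟨by omega, hk⟩))

lemma IsChainTimes.pathwidth_le {V : Type} [Fintype V] [DecidableEq V] {G : SimpleGraph V}
    {C : Set V} {n : ℕ} {q : ℕ → TDQuint V} {b e : V → ℕ} (h : IsChainTimes C n q b e)
    (hv : ∀ i ≤ n, ValidQuintP G C (q i)) (hp : ∀ i < n, IsPredQuint (q i) (q (i + 1)))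
    (hC : IsVertexCover G C) (hne : ∀ x, x ∉ C → (G.neighborSet x).Nonempty) {w : ℕ}
    (hw : ∀ i ≤ n, locpw G C (q i) ≤ w) : pathwidth G ≤ w := by
  let idx : V → ℕ := fun v => Fintype.equivFin V v
  have hidx : Function.Injective idx := fun u v huv =>
    (Fintype.equivFin V).injective (Fin.ext huv)
  obtain ⟨M, hM⟩ : ∃ M, ∀ v, idx v + 2 < M :=
    ⟨Fintype.card V + 2, fun v => Nat.add_lt_add_right (Fintype.equivFin V v).isLt 2⟩
  have hN : ∀ x, x ∉ C → G.neighborSet x ⊆ C := fun x hx c hc => (hC x c hc).resolve_left hx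
  have hmul : ∀ {a c : ℕ}, a ≤ c → M * a ≤ M * c := fun h => Nat.mul_le_mul_left M h
  have hlt : ∀ {a c : ℕ}, a < c → M * a + M ≤ M * c := fun h => Nat.mul_le_mul_left M h
  have hseg : ∀ v, ∃ l r, l ≤ r ∧ r < M * n + M ∧
      (v ∈ C → l = M * b v ∧ r = M * e v + (M - 1)) ∧
      (v ∉ C → ∀ c, G.Adj v c → l ≤ M * e c + (M - 1) ∧ M * b c ≤ r) ∧
      (v ∉ C → ∀ i j, j < M → l ≤ M * i + j → M * i + j ≤ r → v ∈ XTRset G C (q i) ∨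
        (j = 0 ∧ v ∈ XLset G C (q i)) ∨ (j = M - 1 ∧ v ∈ XRset G C (q i)) ∨
        (j = idx v + 1 ∧ v ∈ XFPset G C (q i))) := fun v => by
    by_cases hvC : v ∈ C
    · have h₁ := hmul (h.le v hvC)
      have h₂ := hmul (h.le_last v hvC)
      have h₃ := hM v
      exact ⟨_, _, by omega, by omega, fun _ => ⟨rfl, rfl⟩, fun hn => absurd hvC hn,
        fun hn => absurd hvC hn⟩
    · obtain ⟨l, r, h₁, h₂, h₃, h₄⟩ :=
        h.exists_interval hp M (idx v) (hM v) hvC (hN v hvC) (hne v hvC)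
      exact ⟨l, r, h₁, h₂, fun hn => absurd hn hvC, fun _ => h₃, fun _ => h₄⟩
  choose l r hlr hr hlrC hadj hcov using hseg
  refine pathwidth_le_of_interval hlr hr (fun u v huv => ?_) fun p hpN => ?_
  · by_cases hu : u ∈ C
    · by_cases hvC : v ∈ C
      · have := hmul (h.le_of_adj hv hp hu hvC huv)
        rw [(hlrC u hu).1, (hlrC v hvC).2]
        omega
      · rw [(hlrC u hu).1]
        exact (hadj v hvC u huv.symm).2
    · rw [(hlrC v (hN u hu huv)).2]
      exact (hadj u hu v huv).1
  · rcases isEmpty_or_nonempty V with hV | ⟨⟨v₀⟩⟩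
    · simp [Set.eq_empty_of_isEmpty]
    have hM₀ := hM v₀
    obtain ⟨i, j, hj, rfl⟩ : ∃ i j, j < M ∧ p = M * i + j :=
      ⟨p / M, p % M, Nat.mod_lt _ (by omega), (Nat.div_add_mod p M).symm⟩
    have hin : i ≤ n := by
      by_contra! hn
      have := hlt hn
      omega
    have hcard : ∀ D : Set V, (∀ v, v ∉ C → l v ≤ M * i + j → M * i + j ≤ r v →
          v ∈ XTRset G C (q i) ∨ v ∈ D) →
        D.ncard ≤ max (max (XLset G C (q i)).ncard (XRset G C (q i)).ncard) (epsP G C (q i)) →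
        {v | l v ≤ M * i + j ∧ M * i + j ≤ r v}.ncard ≤ w + 1 := fun D hD hDc => by
      have hsub : {v | l v ≤ M * i + j ∧ M * i + j ≤ r v} ⊆
          (q i).XC ∪ XTRset G C (q i) ∪ D := fun v hvp => by
        by_cases hvC : v ∈ C
        · have h₁ := hvp.1
          have h₂ := hvp.2
          rw [(hlrC v hvC).1] at h₁
          rw [(hlrC v hvC).2] at h₂
          refine Or.inl (Or.inl ((h.mem_XC v hvC i hin).2 ⟨?_, ?_⟩))
          · by_contra! hn
            have := hlt hn
            omega
          · by_contra! hn
            have := hlt hn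
            omega
        · rcases hD v hvC hvp.1 hvp.2 with hv | hv
          · exact Or.inl (Or.inr hv)
          · exact Or.inr hv
      have h₁ := Set.ncard_le_ncard hsub (Set.toFinite _)
      have h₂ := Set.ncard_union_le ((q i).XC ∪ XTRset G C (q i)) D
      have h₃ := Set.ncard_union_le (q i).XC (XTRset G C (q i))
      have h₄ := hw i hin
      rw [locpw] at h₄
      omega
    by_cases hj₀ : j = 0
    · refine hcard (XLset G C (q i)) (fun v hvC h₁ h₂ => ?_)
        ((le_max_left _ _).trans (le_max_left _ _))
      rcases hcov v hvC i j hj h₁ h₂ with hv | hv | hv | hv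
      · exact Or.inl hv
      · exact Or.inr hv.2
      · omega
      · omega
    by_cases hj₁ : j = M - 1
    · refine hcard (XRset G C (q i)) (fun v hvC h₁ h₂ => ?_)
        ((le_max_right _ _).trans (le_max_left _ _))
      rcases hcov v hvC i j hj h₁ h₂ with hv | hv | hv | hv
      · exact Or.inl hv
      · omega
      · exact Or.inr hv.2
      · have := hM v
        omega
    refine hcard {v | j = idx v + 1 ∧ v ∈ XFPset G C (q i)} (fun v hvC h₁ h₂ => ?_) ?_
    · rcases hcov v hvC i j hj h₁ h₂ with hv | hv | hv | hv
      · exact Or.inl hv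
      · omega
      · omega
      · exact Or.inr hv
    · refine le_trans ?_ (le_max_right _ _)
      unfold epsP
      split_ifs with hF
      · rw [Set.ncard_le_one_iff]
        intro u v hu hv
        exact hidx (by have := hu.1; have := hv.1; omega)
      · rw [Set.not_nonempty_iff_eq_empty.1 hF]
        simp

lemma ValidQuintP.pathwidth_le_ppw {V : Type} [Fintype V] [DecidableEq V] {G : SimpleGraph V}
    {z : V} (hz : ∀ v, v ≠ z → G.Adj z v) {C : Set V} (hC : IsVertexCover G C) (hzC : z ∈ C)
    {τ : TDOp V} (hQ : ValidQuintP G C ⟨τ, C \ {z}, {z}, ∅, TDOp.forget z⟩) :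
    pathwidth G ≤ ppw G C ⟨τ, C \ {z}, {z}, ∅, TDOp.forget z⟩ := by
  obtain ⟨n, q, hn, h₀, hv, hp⟩ := hQ.exists_chain (by rw [Set.ncard_singleton])
  obtain ⟨b, e, h⟩ := exists_isChainTimes (z := z) h₀ (by rw [hn]) (by rw [hn]) (by rw [hn])
    (fun i hi => (hv i hi).1) hp
  refine h.pathwidth_le (fun i hi => (hv i hi).1) hp hC (fun x hx => ⟨z, ?_⟩)
    fun i hi => (hv i hi).2
  exact (hz x fun hxz => hx (hxz ▸ hzC)).symm

lemma exists_validQuintP_ppw_le_pathwidth {V : Type} [Fintype V] [DecidableEq V]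
    {G : SimpleGraph V} {z : V} (hz : ∀ v, v ≠ z → G.Adj z v) {C : Set V} (hzC : z ∈ C) :
    ∃ τ, ValidQuintP G C ⟨τ, C \ {z}, {z}, ∅, TDOp.forget z⟩ ∧
      ppw G C ⟨τ, C \ {z}, {z}, ∅, TDOp.forget z⟩ ≤ pathwidth G := by
  obtain ⟨N, d, hd⟩ := exists_pathDecomp_width_eq_pathwidth G
  obtain ⟨n, t, ht, hroot, hzt, hcard⟩ := d.exists_isNicePath hz
  have htr : t.HasTrace C t.root (C \ {z}) {z} ∅ := by
    refine ⟨?_, ?_, ?_⟩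
    · rw [RootedTreeDecomp.Lset, RootedTreeDecomp.subVerts_root, hroot]
      ext v
      simp only [Set.mem_sdiff, Set.mem_inter_iff, Finset.coe_singleton, Set.mem_univ, true_and]
      tauto
    · rw [hroot, Finset.coe_singleton]
      exact (Set.inter_eq_left.2 (Set.singleton_subset_iff.2 hzC)).symm
    · rw [RootedTreeDecomp.Rset, RootedTreeDecomp.subVerts_root]
      simp
  obtain ⟨imin, hmin, hlow⟩ := ht.exists_lowest htr
  obtain ⟨τ, hτ⟩ := ht.exists_hasOp C imin
  have h : RespectsAtND t C ⟨τ, C \ {z}, {z}, ∅, TDOp.forget z⟩ imin t.root :=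
    ⟨hmin, htr, t.reaches_root imin, fun i hi => ⟨hlow i hi, t.reaches_root i⟩, hτ,
      Or.inl ⟨rfl, z, hroot, rfl⟩⟩
  exact ⟨τ, ⟨_, t, ht, imin, t.root, h⟩, h.ppw_le ht (fun i => ⟨z, hzC, hzt i⟩)
    fun i => (hcard i).trans (Nat.add_le_add_right hd 1)⟩

theorem pathwidth_eq_min_ppw {V : Type} [Fintype V] [DecidableEq V]
    (G : SimpleGraph V) (univ : V) (huniv : ∀ v, v ≠ univ → G.Adj univ v)
    (C : Set V) (hC : IsVertexCover G C) (hu : univ ∈ C) :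
    pathwidth G = sInf {n | ∃ τ,
      ValidQuintP G C ⟨τ, C \ {univ}, ({univ} : Set V), ∅, TDOp.forget univ⟩ ∧
      n = ppw G C ⟨τ, C \ {univ}, ({univ} : Set V), ∅, TDOp.forget univ⟩} := by
  obtain ⟨τ, hτ, hle⟩ := exists_validQuintP_ppw_le_pathwidth huniv hu
  refine le_antisymm ?_ (le_trans (Nat.sInf_le ?_) hle)
  · obtain ⟨τ', hτ', h⟩ := Nat.sInf_mem (s := {n | ∃ τ,
      ValidQuintP G C ⟨τ, C \ {univ}, ({univ} : Set V), ∅, TDOp.forget univ⟩ ∧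
      n = ppw G C ⟨τ, C \ {univ}, ({univ} : Set V), ∅, TDOp.forget univ⟩}) ⟨_, τ, hτ, rfl⟩
    rw [h]
    exact hτ'.pathwidth_le_ppw huniv hC hu
  · exact ⟨τ, hτ, rfl⟩
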